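/- arXiv:1004.0282 — 3 statements merged into one kernel-verified Lean document; each statement's English description precedes it below -/
import Mathlib

section
/- Let S_c(t) denote the number of 3×3 semimagic squares all of whose entries lie strictly between 0 and t. Then for every positive integer t divisible by 60, 120·S_c(t) = 36t⁵ − 1125t⁴ + 13240t³ − 71868t² + 175680t − 155520. -/
/-- A 3×3 semimagic square: positive entries, all nine entries distinct, all
row sums and column sums equal. -/
def IsSemimagicSq (x : Matrix (Fin 3) (Fin 3) ℤ) : Prop :=
  (∀ i j, 0 < x i j) ∧
  (Function.Injective fun p : Fin 3 × Fin 3 => x p.1 p.2) ∧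
  ∃ s : ℤ, (∀ i, ∑ j, x i j = s) ∧ (∀ j, ∑ i, x i j = s)

/-- `Sc t` = number of 3×3 semimagic squares all of whose entries lie strictly
between 0 and t. -/
noncomputable def Sc (t : ℕ) : ℕ :=
  {x : Matrix (Fin 3) (Fin 3) ℤ |
    IsSemimagicSq x ∧ ∀ i j, x i j < (t : ℤ)}.ncard

open Finset

lemma rev_sum (T m : ℕ) (g h : ℕ → ℤ) (hm : m ≤ T + 1)
    (h1 : ∀ i, i + 1 < m → g (m - (i + 1)) = h (i + 1)) (h2 : ∀ c, m ≤ c → g c = 0) :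
    ∑ c ∈ Icc 1 T, g c = ∑ i ∈ range (m - 1), h (i + 1) := by
  have hs : ∑ c ∈ Icc 1 T, g c = ∑ c ∈ Ico 1 m, g c := by
    symm
    apply Finset.sum_subset
    · intro c hc
      simp only [Finset.mem_Ico, Finset.mem_Icc] at *
      omega
    · intro c hc hc'
      simp only [Finset.mem_Ico, Finset.mem_Icc] at *
      exact h2 c (by omega)
  rw [hs]
  refine Finset.sum_nbij' (fun c => m - c - 1) (fun i => m - (i + 1)) ?_ ?_ ?_ ?_ ?_
  · intro c hc
    simp only [Finset.mem_Ico, Finset.mem_range] at *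
    omega
  · intro c hc
    simp only [Finset.mem_Ico, Finset.mem_range] at *
    omega
  · intro c hc
    simp only [Finset.mem_Ico, Finset.mem_range] at *
    omega
  · intro c hc
    simp only [Finset.mem_Ico, Finset.mem_range] at *
    omega
  · intro c hc
    simp only [Finset.mem_Ico, Finset.mem_range] at *
    have := h1 (m - c - 1) (by omega)
    rw [← this]
    congr 1
    omega

lemma phi_e (T e s m N : ℕ) (hN : N + s = e * m) (hs : s < e) (hm1 : 1 ≤ m) (hm : m ≤ T + 1) :
    2 * ∑ f ∈ Icc 1 T, ((N - e * f : ℕ) : ℤ) = ((m : ℤ) - 1) * (e * m - 2 * s) := by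
  rw [rev_sum T m _ (fun i => (e : ℤ) * i - s) hm]
  · have : ∀ n : ℕ, 2 * ∑ i ∈ range n, ((e : ℤ) * ((i + 1 : ℕ) : ℤ) - s) = n * (e * (n + 1) - 2 * s) := by
      intro n
      induction n with
      | zero => simp
      | succ n ih =>
        rw [Finset.sum_range_succ, mul_add, ih]
        push_cast
        ring
    rw [this]
    push_cast [hm1]
    ring
  · intro i hi
    have h1 : e * m = e * (m - (i + 1)) + e * (i + 1) := by
      rw [← mul_add]; congr 1; omega
    have h2 : e ≤ e * (i + 1) := Nat.le_mul_of_pos_right e (by omega)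
    have h3 : e * (m - (i + 1)) ≤ N := by omega
    push_cast [h3]
    have h1' : (e : ℤ) * m = e * (m - (i + 1) : ℕ) + e * (i + 1) := by exact_mod_cast h1
    have hN' : (N : ℤ) + s = e * m := by exact_mod_cast hN
    linarith
  · intro c hc
    have : e * m ≤ e * c := Nat.mul_le_mul_left e hc
    have : N - e * c = 0 := by omega
    simp [this]

lemma phi_1 (T N : ℕ) (hm : N ≤ T + 1) :
    2 * ∑ f ∈ Icc 1 T, ((N - f : ℕ) : ℤ) = ((N : ℤ) - 1) * N := by
  rcases Nat.eq_zero_or_pos N with h | h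
  · subst h; simp
  · have := phi_e T 1 0 N N (by omega) (by omega) h hm
    simpa using this

lemma phi_A (T N : ℕ) (A : ℤ) (hm : N ≤ T + 1) :
    6 * ∑ f ∈ Icc 1 T, ((N - f : ℕ) : ℤ) * (A + f) =
      3 * A * ((N - 1) * N) + ((N : ℤ) - 1) * N * (N + 1) := by
  rw [rev_sum T N _ (fun i => (i : ℤ) * (A + N - i)) hm]
  · rcases Nat.eq_zero_or_pos N with h | h
    · subst h; simp
    · have : ∀ n : ℕ, 6 * ∑ i ∈ range n, (((i + 1 : ℕ) : ℤ) * (A + N - ((i + 1 : ℕ) : ℤ)))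
          = 3 * (A + N) * (n * (n + 1)) - n * (n + 1) * (2 * n + 1) := by
        intro n
        induction n with
        | zero => simp
        | succ n ih =>
          rw [Finset.sum_range_succ, mul_add, ih]
          push_cast
          ring
      rw [this]
      push_cast [h]
      ring
  · intro i hi
    have h1 : N - (N - (i + 1)) = i + 1 := by omega
    rw [h1]
    have h2 : ((N - (i + 1) : ℕ) : ℤ) = N - (i + 1) := by
      have : i + 1 ≤ N := by omega
      push_cast [this]; ring
    rw [h2]
    push_cast
    ring
  · intro c hc
    have : N - c = 0 := by omega
    simp [this]

lemma S5 (k : ℕ) (hk : 0 < k) :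
    2 * ∑ c ∈ Icc 1 (60 * k - 1), ((60 * k - 1 - 5 * c : ℕ) : ℤ) = (12 * k - 1) * (60 * k - 2) := by
  rw [phi_e (60 * k - 1) 5 1 (12 * k) (60 * k - 1) (by omega) (by omega) (by omega) (by omega)]
  push_cast
  ring

lemma S41 (k : ℕ) (hk : 0 < k) :
    6 * ∑ c ∈ Icc 1 (60 * k - 1), ∑ f ∈ Icc 1 (60 * k - 1), ((60 * k - 1 - (4 * c + f) : ℕ) : ℤ)
      = -4 * (15 * k - 1) + 6 * (15 * k - 1) ^ 2 + 16 * (15 * k - 1) ^ 3 := by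
  have e : ∀ c : ℕ, 2 * ∑ f ∈ Icc 1 (60 * k - 1), ((60 * k - 1 - (4 * c + f) : ℕ) : ℤ)
      = (((60 * k - 1 - 4 * c : ℕ) : ℤ) - 1) * ((60 * k - 1 - 4 * c : ℕ) : ℤ) := by
    intro c
    rw [← phi_1 (60 * k - 1) _ (by omega)]
    simp only [Nat.sub_sub, add_assoc]
  have : 2 * ∑ c ∈ Icc 1 (60 * k - 1), ∑ f ∈ Icc 1 (60 * k - 1),
      ((60 * k - 1 - (4 * c + f) : ℕ) : ℤ) = ∑ i ∈ range (15 * k - 1),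
        (4 * ((i + 1 : ℕ) : ℤ) - 2) * (4 * ((i + 1 : ℕ) : ℤ) - 1) := by
    rw [Finset.mul_sum]
    simp only [e]
    apply rev_sum _ (15 * k) _ (fun i => (4 * (i : ℤ) - 2) * (4 * (i : ℤ) - 1)) (by omega)
    · intro i hi
      have : 60 * k - 1 - 4 * (15 * k - (i + 1)) = 4 * i + 3 := by omega
      rw [this]; push_cast; ring
    · intro c hc
      have : 60 * k - 1 - 4 * c = 0 := by omega
      rw [this]; simp
  have h2 : ∀ n : ℕ, 3 * ∑ i ∈ range n,
        (4 * ((i + 1 : ℕ) : ℤ) - 2) * (4 * ((i + 1 : ℕ) : ℤ) - 1) = -4 * n + 6 * n ^ 2 + 16 * n ^ 3 := by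
    intro n
    induction n with
    | zero => simp
    | succ n ih =>
      rw [Finset.sum_range_succ, mul_add, ih]
      push_cast
      ring
  have h3 := h2 (15 * k - 1)
  have h4 : ((15 * k - 1 : ℕ) : ℤ) = 15 * k - 1 := by
    have : 1 ≤ 15 * k := by omega
    push_cast [this]; ring
  rw [h4] at h3
  rw [← h3, ← this]
  ring

lemma S33 (k : ℕ) (hk : 0 < k) :
    2 * ∑ c ∈ Icc 1 (60 * k - 1), ∑ f ∈ Icc 1 (60 * k - 1), ((60 * k - 1 - (3 * c + 3 * f) : ℕ) : ℤ)
      = - (20 * k - 1) ^ 2 + (20 * k - 1) ^ 3 := by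
  have : 2 * ∑ c ∈ Icc 1 (60 * k - 1), ∑ f ∈ Icc 1 (60 * k - 1),
      ((60 * k - 1 - (3 * c + 3 * f) : ℕ) : ℤ) = ∑ i ∈ range (20 * k - 1),
        (((i + 1 : ℕ) : ℤ) - 1) * (3 * ((i + 1 : ℕ) : ℤ) - 2) := by
    rw [Finset.mul_sum]
    simp only [← Nat.sub_sub]
    apply rev_sum _ (20 * k) _ (fun i => ((i : ℤ) - 1) * (3 * (i : ℤ) - 2)) (by omega)
    · intro i hi
      rw [phi_e (60 * k - 1) 3 1 (i + 1) _ (by omega) (by omega) (by omega) (by omega)]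
      push_cast; ring
    · intro c hc
      have : 60 * k - 1 - 3 * c = 0 := by omega
      simp [this]
  have h2 : ∀ n : ℕ, ∑ i ∈ range n,
        (((i + 1 : ℕ) : ℤ) - 1) * (3 * ((i + 1 : ℕ) : ℤ) - 2) = - n ^ 2 + n ^ 3 := by
    intro n
    induction n with
    | zero => simp
    | succ n ih =>
      rw [Finset.sum_range_succ, ih]
      push_cast
      ring
  have h4 : ((20 * k - 1 : ℕ) : ℤ) = 20 * k - 1 := by
    have : 1 ≤ 20 * k := by omega
    push_cast [this]; ring
  rw [this, h2, h4]

lemma S32 (k : ℕ) (hk : 0 < k) :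
    2 * ∑ c ∈ Icc 1 (60 * k - 1), ∑ f ∈ Icc 1 (60 * k - 1), ((60 * k - 1 - (3 * c + 2 * f) : ℕ) : ℤ)
      = 5 * (10 * k - 1) + 15 * (10 * k - 1) ^ 2 + 12 * (10 * k - 1) ^ 3 := by
  have : 2 * ∑ c ∈ Icc 1 (60 * k - 1), ∑ f ∈ Icc 1 (60 * k - 1),
      ((60 * k - 1 - (3 * c + 2 * f) : ℕ) : ℤ) = ∑ i ∈ range (20 * k - 1),
        (((3 * (i + 1) / 2 : ℕ) : ℤ) - 1) *
          (2 * ((3 * (i + 1) / 2 : ℕ) : ℤ) - 2 * ((2 * (3 * (i + 1) / 2) - (3 * (i + 1) - 1) : ℕ) : ℤ)) := by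
    rw [Finset.mul_sum]
    simp only [← Nat.sub_sub]
    apply rev_sum _ (20 * k) _ (fun i => (((3 * i / 2 : ℕ) : ℤ) - 1) *
          (2 * ((3 * i / 2 : ℕ) : ℤ) - 2 * ((2 * (3 * i / 2) - (3 * i - 1) : ℕ) : ℤ))) (by omega)
    · intro i hi
      rw [phi_e (60 * k - 1) 2 (2 * (3 * (i + 1) / 2) - (3 * (i + 1) - 1)) (3 * (i + 1) / 2) _
        (by omega) (by omega) (by omega) (by omega)]
      push_cast; ring
    · intro c hc
      have : 60 * k - 1 - 3 * c = 0 := by omega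
      simp [this]
  have h2 : ∀ n : ℕ, ∑ i ∈ range (2 * n + 1), (((3 * (i + 1) / 2 : ℕ) : ℤ) - 1) *
          (2 * ((3 * (i + 1) / 2 : ℕ) : ℤ) - 2 * ((2 * (3 * (i + 1) / 2) - (3 * (i + 1) - 1) : ℕ) : ℤ))
            = 5 * n + 15 * n ^ 2 + 12 * n ^ 3 := by
    intro n
    induction n with
    | zero => simp
    | succ n ih =>
      rw [show 2 * (n + 1) + 1 = 2 * n + 1 + 1 + 1 by ring, Finset.sum_range_succ,
        Finset.sum_range_succ, ih]
      rw [show 3 * (2 * n + 1 + 1) / 2 = 3 * n + 3 by omega,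
        show 3 * (2 * n + 1 + 1 + 1) / 2 = 3 * n + 4 by omega,
        show 2 * (3 * n + 3) - (3 * (2 * n + 1 + 1) - 1) = 1 by omega,
        show 2 * (3 * n + 4) - (3 * (2 * n + 1 + 1 + 1) - 1) = 0 by omega]
      push_cast
      ring
  have h4 : ((10 * k - 1 : ℕ) : ℤ) = 10 * k - 1 := by
    have : 1 ≤ 10 * k := by omega
    push_cast [this]; ring
  rw [this, show 20 * k - 1 = 2 * (10 * k - 1) + 1 by omega, h2, h4]

lemma S43 (k : ℕ) (hk : 0 < k) :
    2 * ∑ c ∈ Icc 1 (60 * k - 1), ∑ f ∈ Icc 1 (60 * k - 1), ((60 * k - 1 - (4 * c + 3 * f) : ℕ) : ℤ)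
      = 10 + 54 * (5 * k - 1) + 90 * (5 * k - 1) ^ 2 + 48 * (5 * k - 1) ^ 3 := by
  have : 2 * ∑ c ∈ Icc 1 (60 * k - 1), ∑ f ∈ Icc 1 (60 * k - 1),
      ((60 * k - 1 - (4 * c + 3 * f) : ℕ) : ℤ) = ∑ i ∈ range (15 * k - 1),
        ((((4 * (i + 1) + 1) / 3 : ℕ) : ℤ) - 1) * (3 * (((4 * (i + 1) + 1) / 3 : ℕ) : ℤ)
          - 2 * ((3 * ((4 * (i + 1) + 1) / 3) - (4 * (i + 1) - 1) : ℕ) : ℤ)) := by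
    rw [Finset.mul_sum]
    simp only [← Nat.sub_sub]
    apply rev_sum _ (15 * k) _ (fun i => ((((4 * i + 1) / 3 : ℕ) : ℤ) - 1) *
      (3 * (((4 * i + 1) / 3 : ℕ) : ℤ)
          - 2 * ((3 * ((4 * i + 1) / 3) - (4 * i - 1) : ℕ) : ℤ))) (by omega)
    · intro i hi
      rw [phi_e (60 * k - 1) 3 (3 * ((4 * (i + 1) + 1) / 3) - (4 * (i + 1) - 1))
        ((4 * (i + 1) + 1) / 3) _ (by omega) (by omega) (by omega) (by omega)]
      push_cast; ring
    · intro c hc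
      have : 60 * k - 1 - 4 * c = 0 := by omega
      simp [this]
  have h2 : ∀ n : ℕ, ∑ i ∈ range (3 * n + 2), ((((4 * (i + 1) + 1) / 3 : ℕ) : ℤ) - 1) *
      (3 * (((4 * (i + 1) + 1) / 3 : ℕ) : ℤ)
          - 2 * ((3 * ((4 * (i + 1) + 1) / 3) - (4 * (i + 1) - 1) : ℕ) : ℤ))
            = 10 + 54 * n + 90 * n ^ 2 + 48 * n ^ 3 := by
    intro n
    induction n with
    | zero => simp [Finset.sum_range_succ]
    | succ n ih =>
      rw [show 3 * (n + 1) + 2 = 3 * n + 2 + 1 + 1 + 1 by ring, Finset.sum_range_succ,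
        Finset.sum_range_succ, Finset.sum_range_succ, ih]
      rw [show (4 * (3 * n + 2 + 1) + 1) / 3 = 4 * n + 4 by omega,
        show (4 * (3 * n + 2 + 1 + 1) + 1) / 3 = 4 * n + 5 by omega,
        show (4 * (3 * n + 2 + 1 + 1 + 1) + 1) / 3 = 4 * n + 7 by omega,
        show 3 * (4 * n + 4) - (4 * (3 * n + 2 + 1) - 1) = 1 by omega,
        show 3 * (4 * n + 5) - (4 * (3 * n + 2 + 1 + 1) - 1) = 0 by omega,
        show 3 * (4 * n + 7) - (4 * (3 * n + 2 + 1 + 1 + 1) - 1) = 2 by omega]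
      push_cast
      ring
  have h4 : ((5 * k - 1 : ℕ) : ℤ) = 5 * k - 1 := by
    have : 1 ≤ 5 * k := by omega
    push_cast [this]; ring
  rw [this, show 15 * k - 1 = 3 * (5 * k - 1) + 2 by omega, h2, h4]

lemma Smain (k : ℕ) (hk : 0 < k) :
    60 * ∑ c ∈ Icc 1 (60 * k - 1), ∑ d ∈ Icc 1 (60 * k - 1), ∑ f ∈ Icc 1 (60 * k - 1),
      ((60 * k - 1 - (2 * c + 2 * d + f) : ℕ) : ℤ) * (c + d + f - 7)
      = 2 * (30 * k - 1) - 145 * (30 * k - 1) ^ 2 + 210 * (30 * k - 1) ^ 3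
        - 65 * (30 * k - 1) ^ 4 - 2 * (30 * k - 1) ^ 5
        + 10 * (30 * k) * (2 * (30 * k - 1) ^ 2 - 3 * (30 * k - 1) ^ 3 + (30 * k - 1) ^ 4) := by
  have e : ∀ c d : ℕ, 6 * ∑ f ∈ Icc 1 (60 * k - 1),
      ((60 * k - 1 - (2 * c + 2 * d + f) : ℕ) : ℤ) * (c + d + f - 7)
      = 3 * ((c : ℤ) + d - 7) * ((((60 * k - 1 - (2 * c + 2 * d) : ℕ) : ℤ) - 1)
          * ((60 * k - 1 - (2 * c + 2 * d) : ℕ) : ℤ)) +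
        (((60 * k - 1 - (2 * c + 2 * d) : ℕ) : ℤ) - 1)
          * ((60 * k - 1 - (2 * c + 2 * d) : ℕ) : ℤ) *
            (((60 * k - 1 - (2 * c + 2 * d) : ℕ) : ℤ) + 1) := by
    intro c d
    rw [← phi_A (60 * k - 1) _ _ (by omega)]
    simp only [Nat.sub_sub]
    congr 1
    apply Finset.sum_congr rfl
    intro f _
    ring
  have hP : ∀ n : ℕ, ∑ i ∈ range n, (3 * (30 * (k : ℤ) - 7 - ((i + 1 : ℕ) : ℤ)) *
      ((2 * ((i + 1 : ℕ) : ℤ) - 2) * (2 * ((i + 1 : ℕ) : ℤ) - 1)) + (2 * ((i + 1 : ℕ) : ℤ) - 2) *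
      (2 * ((i + 1 : ℕ) : ℤ) - 1) * (2 * ((i + 1 : ℕ) : ℤ))) =
      7 * n + 22 * n ^ 2 - 28 * n ^ 3 - n ^ 4 + 30 * k * (- n - 3 * n ^ 2 + 4 * n ^ 3) := by
    intro n
    induction n with
    | zero => simp
    | succ n ih =>
      rw [Finset.sum_range_succ, ih]
      push_cast
      ring
  have e2 : ∀ c : ℕ, 1 ≤ c → 6 * ∑ d ∈ Icc 1 (60 * k - 1), ∑ f ∈ Icc 1 (60 * k - 1),
      ((60 * k - 1 - (2 * c + 2 * d + f) : ℕ) : ℤ) * (c + d + f - 7) =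
      ∑ i ∈ range (30 * k - c - 1), (3 * (30 * (k : ℤ) - 7 - ((i + 1 : ℕ) : ℤ)) *
      ((2 * ((i + 1 : ℕ) : ℤ) - 2) * (2 * ((i + 1 : ℕ) : ℤ) - 1)) + (2 * ((i + 1 : ℕ) : ℤ) - 2) *
      (2 * ((i + 1 : ℕ) : ℤ) - 1) * (2 * ((i + 1 : ℕ) : ℤ))) := by
    intro c hc
    rw [Finset.mul_sum]
    simp only [e]
    apply rev_sum _ (30 * k - c) _ (fun i => (3 * (30 * (k : ℤ) - 7 - (i : ℤ)) *
      ((2 * (i : ℤ) - 2) * (2 * (i : ℤ) - 1)) + (2 * (i : ℤ) - 2) *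
      (2 * (i : ℤ) - 1) * (2 * (i : ℤ)))) (by omega)
    · intro i hi
      have h1 : 60 * k - 1 - (2 * c + 2 * (30 * k - c - (i + 1))) = 2 * i + 1 := by omega
      have h2 : ((30 * k - c - (i + 1) : ℕ) : ℤ) = 30 * k - c - (i + 1) := by omega
      rw [h1, h2]
      push_cast
      ring
    · intro d hd
      have : 60 * k - 1 - (2 * c + 2 * d) = 0 := by omega
      rw [this]; simp
  have h3 : 6 * ∑ c ∈ Icc 1 (60 * k - 1), ∑ d ∈ Icc 1 (60 * k - 1), ∑ f ∈ Icc 1 (60 * k - 1),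
      ((60 * k - 1 - (2 * c + 2 * d + f) : ℕ) : ℤ) * (c + d + f - 7) =
      ∑ i ∈ range (30 * k - 1), (7 * (((i + 1 : ℕ) : ℤ) - 1) + 22 * (((i + 1 : ℕ) : ℤ) - 1) ^ 2
        - 28 * (((i + 1 : ℕ) : ℤ) - 1) ^ 3 - (((i + 1 : ℕ) : ℤ) - 1) ^ 4 +
        30 * k * (- (((i + 1 : ℕ) : ℤ) - 1) - 3 * (((i + 1 : ℕ) : ℤ) - 1) ^ 2
          + 4 * (((i + 1 : ℕ) : ℤ) - 1) ^ 3)) := by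
    rw [Finset.mul_sum]
    rw [Finset.sum_congr rfl (fun c hc => (e2 c (Finset.mem_Icc.1 hc).1).trans (hP _))]
    apply rev_sum _ (30 * k) _ (fun i => (7 * ((i : ℤ) - 1) + 22 * ((i : ℤ) - 1) ^ 2
        - 28 * ((i : ℤ) - 1) ^ 3 - ((i : ℤ) - 1) ^ 4 +
        30 * k * (- ((i : ℤ) - 1) - 3 * ((i : ℤ) - 1) ^ 2
          + 4 * ((i : ℤ) - 1) ^ 3))) (by omega)
    · intro i hi
      have h1 : 30 * k - (30 * k - (i + 1)) - 1 = i := by omega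
      rw [h1]
      push_cast
      ring
    · intro c hc
      have : 30 * k - c - 1 = 0 := by omega
      rw [this]; simp
  have h5 : ∀ n : ℕ, 10 * ∑ i ∈ range n, (7 * (((i + 1 : ℕ) : ℤ) - 1) + 22 * (((i + 1 : ℕ) : ℤ) - 1) ^ 2
        - 28 * (((i + 1 : ℕ) : ℤ) - 1) ^ 3 - (((i + 1 : ℕ) : ℤ) - 1) ^ 4 +
        30 * k * (- (((i + 1 : ℕ) : ℤ) - 1) - 3 * (((i + 1 : ℕ) : ℤ) - 1) ^ 2
          + 4 * (((i + 1 : ℕ) : ℤ) - 1) ^ 3)) = 2 * (n : ℤ) - 145 * (n : ℤ) ^ 2 + 210 * (n : ℤ) ^ 3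
        - 65 * (n : ℤ) ^ 4 - 2 * (n : ℤ) ^ 5
        + 10 * (30 * (k : ℤ)) * (2 * (n : ℤ) ^ 2 - 3 * (n : ℤ) ^ 3 + (n : ℤ) ^ 4) := by
    intro n
    induction n with
    | zero => simp
    | succ n ih =>
      rw [Finset.sum_range_succ, mul_add, ih]
      push_cast
      ring
  have h4 : ((30 * k - 1 : ℕ) : ℤ) = 30 * k - 1 := by omega
  have h6 := h5 (30 * k - 1)
  rw [← h3, h4] at h6
  rw [← h6]
  ring

def Good (a b c d : ℕ) : Prop :=
  a ≠ c ∧ a ≠ d ∧ b ≠ c ∧ b ≠ d ∧ a + b ≠ c ∧ a + b ≠ d ∧ a ≠ c + d ∧ b ≠ c + d ∧ a + b ≠ c + d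

instance (a b c d : ℕ) : Decidable (Good a b c d) := by
  unfold Good; infer_instance

def QQ (T : ℕ) : Finset (ℕ × ℕ × ℕ × ℕ × ℕ) :=
  (Icc 1 T ×ˢ Icc 1 T ×ˢ Icc 1 T ×ˢ Icc 1 T ×ˢ Icc 1 T).filter
    (fun x => Good x.2.2.1 x.2.2.2.1 x.1 x.2.1 ∧
      x.2.2.2.2 + (x.2.2.1 + x.2.2.2.1 + x.1 + x.2.1) ≤ T)

lemma ysum (T s : ℕ) :
    ∑ y ∈ Icc 1 T, (if y + s ≤ T then (1 : ℤ) else 0) = ((T - s : ℕ) : ℤ) := by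
  rw [Finset.sum_boole]
  have : (Icc 1 T).filter (fun y => y + s ≤ T) = Icc 1 (T - s) := by
    ext y
    simp only [Finset.mem_filter, Finset.mem_Icc]
    omega
  rw [this]
  simp

lemma cardQ (T : ℕ) : ((QQ T).card : ℤ) = ∑ c ∈ Icc 1 T, ∑ d ∈ Icc 1 T, ∑ a ∈ Icc 1 T, ∑ b ∈ Icc 1 T,
    (if Good a b c d then ((T - (a + b + c + d) : ℕ) : ℤ) else 0) := by
  rw [QQ, Finset.card_filter]
  push_cast
  simp only [Finset.sum_product]
  refine Finset.sum_congr rfl fun c _ => Finset.sum_congr rfl fun d _ =>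
    Finset.sum_congr rfl fun a _ => Finset.sum_congr rfl fun b _ => ?_
  by_cases h : Good a b c d
  · rw [if_pos h, ← ysum]
    refine Finset.sum_congr rfl fun y _ => ?_
    simp only [h, true_and]
  · rw [if_neg h]
    apply Finset.sum_eq_zero
    intro y _
    rw [if_neg]
    exact fun hh => h hh.1

lemma splitQ (T : ℕ) : ((QQ T).card : ℤ) = 2 * ∑ c ∈ Icc 1 T, ∑ d ∈ Icc 1 T, ∑ a ∈ Icc 1 T,
    ∑ b ∈ Icc 1 T,
    (if c + d < a + b ∧ Good a b c d then ((T - (a + b + c + d) : ℕ) : ℤ) else 0) := by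
  have h1 : ∀ a b c d : ℕ, (if Good a b c d then ((T - (a + b + c + d) : ℕ) : ℤ) else 0) =
      (if c + d < a + b ∧ Good a b c d then ((T - (a + b + c + d) : ℕ) : ℤ) else 0) +
      (if a + b < c + d ∧ Good c d a b then ((T - (c + d + a + b) : ℕ) : ℤ) else 0) := by
    intro a b c d
    by_cases h : Good a b c d
    · have h' : Good c d a b := by unfold Good at *; omega
      have e : c + d + a + b = a + b + c + d := by ring
      rw [e]
      simp only [h, h', and_true, if_true]
      have := h.2.2.2.2.2.2.2.2
      split_ifs <;> first | omega | simp
    · have h' : ¬ Good c d a b := by unfold Good at *; omega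
      simp only [h, h', and_false, if_false]
      simp
  rw [cardQ]
  simp only [h1, Finset.sum_add_distrib]
  rw [two_mul]
  congr 1
  simp only [← Finset.sum_product' (Icc 1 T) (Icc 1 T)]
  rw [Finset.sum_comm]

lemma dec_cases (p : Prop) : (p ∧ p = True) ∨ (¬ p ∧ p = False) := by
  by_cases h : p <;> simp [h]

set_option maxHeartbeats 1000000 in
lemma coef (T c d f : ℕ) (hc : 1 ≤ c) (hd : 1 ≤ d) (hf : 1 ≤ f) (hT : c + d + f ≤ T) :
    ∑ a ∈ Icc 1 T, (if a < c + d + f ∧ Good a (c + d + f - a) c d then (1 : ℤ) else 0) =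
      ((c : ℤ) + d + f - 7) + (if c = d + f then 1 else 0) + (if d = c + f then 1 else 0)
      + (if f = c + d then 1 else 0) + 2 * (if f = c then 1 else 0) + 2 * (if f = d then 1 else 0)
      + 2 * (if c = d then 1 else 0) - 2 * (if c = d ∧ f = c then 1 else 0) := by
  rw [Finset.sum_boole]
  have e : (Icc 1 T).filter (fun a => a < c + d + f ∧ Good a (c + d + f - a) c d) =
      Icc 1 (c + d + f - 1) \ {c, d, c + d, d + f, c + f, f} := by
    ext a
    rw [Finset.mem_filter]
    simp only [Finset.mem_Icc, Finset.mem_sdiff, Finset.mem_insert,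
      Finset.mem_singleton, Good]
    omega
  have hsub : ({c, d, c + d, d + f, c + f, f} : Finset ℕ) ⊆ Icc 1 (c + d + f - 1) := by
    intro a
    simp only [Finset.mem_Icc, Finset.mem_insert, Finset.mem_singleton]
    omega
  have hle := Finset.card_le_card hsub
  rw [e, Finset.card_sdiff_of_subset hsub, Nat.cast_sub hle]
  simp only [Nat.card_Icc, Finset.card_insert_eq_ite, Finset.card_singleton, Finset.mem_insert,
      Finset.mem_singleton]
  clear hle hsub e
  have h0 : ((c + d + f - 1 + 1 - 1 : ℕ) : ℤ) = c + d + f - 1 := by omega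
  rw [h0]
  have f1 : (c = c + d) = False := eq_false (by omega)
  have f2 : (c = c + f) = False := eq_false (by omega)
  have f3 : (d = c + d) = False := eq_false (by omega)
  have f4 : (d = d + f) = False := eq_false (by omega)
  have f5 : (d + f = f) = False := eq_false (by omega)
  have f6 : (c + f = f) = False := eq_false (by omega)
  have g1 : (c = f) = (f = c) := propext (by omega)
  have g2 : (d = f) = (f = d) := propext (by omega)
  have g3 : (c + d = d + f) = (f = c) := propext (by omega)
  have g4 : (c + d = c + f) = (f = d) := propext (by omega)
  have g5 : (c + d = f) = (f = c + d) := propext (by omega)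
  have g6 : (d + f = c + f) = (c = d) := propext (by omega)
  simp only [f1, f2, f3, f4, f5, f6, g1, g2, g3, g4, g5, g6]
  clear f1 f2 f3 f4 f5 f6 g1 g2 g3 g4 g5 g6 h0
  rcases dec_cases (c = d) with ⟨p1, q1⟩ | ⟨p1, q1⟩ <;>
  rcases dec_cases (f = c) with ⟨p2, q2⟩ | ⟨p2, q2⟩ <;>
  rcases dec_cases (f = d) with ⟨p3, q3⟩ | ⟨p3, q3⟩ <;>
  first
  | (exfalso; omega)
  | (rcases dec_cases (c = d + f) with ⟨p4, q4⟩ | ⟨p4, q4⟩ <;>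
    rcases dec_cases (d = c + f) with ⟨p5, q5⟩ | ⟨p5, q5⟩ <;>
    rcases dec_cases (f = c + d) with ⟨p6, q6⟩ | ⟨p6, q6⟩ <;>
    first
    | (exfalso; omega)
    | (simp only [q1, q2, q3, q4, q5, q6, if_true, if_false, or_true, true_or, or_false, false_or,
        and_true, and_false, true_and, false_and]
       push_cast
       ring))

lemma innerQ (T c d : ℕ) (hc : 1 ≤ c) (hd : 1 ≤ d) :
    ∑ a ∈ Icc 1 T, ∑ b ∈ Icc 1 T,
    (if c + d < a + b ∧ Good a b c d then ((T - (a + b + c + d) : ℕ) : ℤ) else 0) =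
    ∑ f ∈ Icc 1 T, ((T - (2 * c + 2 * d + f) : ℕ) : ℤ) *
      (((c : ℤ) + d + f - 7) + (if c = d + f then 1 else 0) + (if d = c + f then 1 else 0)
      + (if f = c + d then 1 else 0) + 2 * (if f = c then 1 else 0) + 2 * (if f = d then 1 else 0)
      + 2 * (if c = d then 1 else 0) - 2 * (if c = d ∧ f = c then 1 else 0)) := by
  have h1 : ∀ f ∈ Icc 1 T, ((T - (2 * c + 2 * d + f) : ℕ) : ℤ) *
      (((c : ℤ) + d + f - 7) + (if c = d + f then 1 else 0) + (if d = c + f then 1 else 0)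
      + (if f = c + d then 1 else 0) + 2 * (if f = c then 1 else 0) + 2 * (if f = d then 1 else 0)
      + 2 * (if c = d then 1 else 0) - 2 * (if c = d ∧ f = c then 1 else 0)) =
      ∑ a ∈ Icc 1 T, (if a < c + d + f ∧ Good a (c + d + f - a) c d then
        ((T - (2 * c + 2 * d + f) : ℕ) : ℤ) else 0) := by
    intro f hf
    by_cases h : c + d + f ≤ T
    · rw [← coef T c d f hc hd (Finset.mem_Icc.1 hf).1 h, Finset.mul_sum]
      simp only [mul_ite, mul_one, mul_zero]
    · have : T - (2 * c + 2 * d + f) = 0 := by omega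
      simp [this]
  rw [Finset.sum_congr rfl h1, Finset.sum_comm (s := Icc 1 T) (t := Icc 1 T)
    (f := fun f a => (if a < c + d + f ∧ Good a (c + d + f - a) c d then
        ((T - (2 * c + 2 * d + f) : ℕ) : ℤ) else 0))]
  refine Finset.sum_congr rfl fun a ha => ?_
  rw [Finset.mem_Icc] at ha
  refine Finset.sum_bij_ne_zero (fun b _ _ => a + b - (c + d)) ?_ ?_ ?_ ?_
  · intro b hb h
    simp only [ne_eq, ite_eq_right_iff, Classical.not_imp, Nat.cast_eq_zero] at h
    rw [Finset.mem_Icc] at *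
    omega
  · intro b hb h b' hb' h' hh
    simp only [ne_eq, ite_eq_right_iff, Classical.not_imp, Nat.cast_eq_zero] at h h'
    omega
  · intro f hf h
    simp only [ne_eq, ite_eq_right_iff, Classical.not_imp, Nat.cast_eq_zero] at h
    obtain ⟨⟨h1, h2⟩, h3⟩ := h
    rw [Finset.mem_Icc] at *
    refine ⟨c + d + f - a, ?_, ?_, ?_⟩
    · rw [Finset.mem_Icc]; omega
    · rw [if_pos ⟨by omega, h2⟩]
      simp only [ne_eq, Nat.cast_eq_zero]
      omega
    · omega
  · intro b hb h
    simp only [ne_eq, ite_eq_right_iff, Classical.not_imp, Nat.cast_eq_zero] at h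
    obtain ⟨⟨h1, h2⟩, h3⟩ := h
    rw [Finset.mem_Icc] at hb
    have e1 : c + d + (a + b - (c + d)) - a = b := by omega
    have e2 : 2 * c + 2 * d + (a + b - (c + d)) = a + b + c + d := by omega
    rw [e1, e2, if_pos ⟨h1, h2⟩, if_pos ⟨by omega, h2⟩]

lemma pick (T m : ℕ) (F : ℕ → ℤ) (hm : 1 ≤ m) (h : T < m → F m = 0) :
    ∑ f ∈ Icc 1 T, F f * (if f = m then 1 else 0) = F m := by
  simp only [mul_ite, mul_one, mul_zero]
  rw [Finset.sum_ite_eq']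
  split_ifs with hh
  · rfl
  · rw [Finset.mem_Icc] at hh
    exact (h (by omega)).symm

lemma totalQ (T : ℕ) : ((QQ T).card : ℤ) = 2 *
    (∑ c ∈ Icc 1 T, ∑ d ∈ Icc 1 T, ∑ f ∈ Icc 1 T,
      ((T - (2 * c + 2 * d + f) : ℕ) : ℤ) * (c + d + f - 7)
    + 2 * ∑ c ∈ Icc 1 T, ∑ f ∈ Icc 1 T, ((T - (4 * c + 3 * f) : ℕ) : ℤ)
    + ∑ c ∈ Icc 1 T, ∑ f ∈ Icc 1 T, ((T - (3 * c + 3 * f) : ℕ) : ℤ)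
    + 4 * ∑ c ∈ Icc 1 T, ∑ f ∈ Icc 1 T, ((T - (3 * c + 2 * f) : ℕ) : ℤ)
    + 2 * ∑ c ∈ Icc 1 T, ∑ f ∈ Icc 1 T, ((T - (4 * c + f) : ℕ) : ℤ)
    - 2 * ∑ c ∈ Icc 1 T, ((T - 5 * c : ℕ) : ℤ)) := by
  rw [splitQ, Finset.sum_congr rfl fun c hc => Finset.sum_congr rfl fun d hd =>
    innerQ T c d (Finset.mem_Icc.1 hc).1 (Finset.mem_Icc.1 hd).1]
  simp only [mul_add, mul_sub, Finset.sum_add_distrib, Finset.sum_sub_distrib]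
  have t1 : ∑ c ∈ Icc 1 T, ∑ d ∈ Icc 1 T, ∑ f ∈ Icc 1 T,
      ((T - (2 * c + 2 * d + f) : ℕ) : ℤ) * (if c = d + f then 1 else 0) =
      ∑ c ∈ Icc 1 T, ∑ f ∈ Icc 1 T, ((T - (4 * c + 3 * f) : ℕ) : ℤ) := by
    rw [Finset.sum_comm]
    refine Finset.sum_congr rfl fun d hd => ?_
    rw [Finset.sum_comm]
    refine Finset.sum_congr rfl fun f hf => ?_
    rw [Finset.mem_Icc] at hd hf
    rw [pick T (d + f) (fun c => ((T - (2 * c + 2 * d + f) : ℕ) : ℤ)) (by omega) (by intro; omega)]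
    congr 1; omega
  have t2 : ∑ c ∈ Icc 1 T, ∑ d ∈ Icc 1 T, ∑ f ∈ Icc 1 T,
      ((T - (2 * c + 2 * d + f) : ℕ) : ℤ) * (if d = c + f then 1 else 0) =
      ∑ c ∈ Icc 1 T, ∑ f ∈ Icc 1 T, ((T - (4 * c + 3 * f) : ℕ) : ℤ) := by
    refine Finset.sum_congr rfl fun d hd => ?_
    rw [Finset.sum_comm]
    refine Finset.sum_congr rfl fun f hf => ?_
    rw [Finset.mem_Icc] at hd hf
    rw [pick T (d + f) (fun c => ((T - (2 * d + 2 * c + f) : ℕ) : ℤ)) (by omega) (by intro; omega)]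
    congr 1; omega
  have t3 : ∑ c ∈ Icc 1 T, ∑ d ∈ Icc 1 T, ∑ f ∈ Icc 1 T,
      ((T - (2 * c + 2 * d + f) : ℕ) : ℤ) * (if f = c + d then 1 else 0) =
      ∑ c ∈ Icc 1 T, ∑ f ∈ Icc 1 T, ((T - (3 * c + 3 * f) : ℕ) : ℤ) := by
    refine Finset.sum_congr rfl fun c hd => Finset.sum_congr rfl fun d hf => ?_
    rw [Finset.mem_Icc] at hd hf
    rw [pick T (c + d) (fun f => ((T - (2 * c + 2 * d + f) : ℕ) : ℤ)) (by omega) (by intro; omega)]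
    congr 1; omega
  have t4 : ∑ c ∈ Icc 1 T, ∑ d ∈ Icc 1 T, ∑ f ∈ Icc 1 T,
      ((T - (2 * c + 2 * d + f) : ℕ) : ℤ) * (2 * (if f = c then 1 else 0)) =
      2 * ∑ c ∈ Icc 1 T, ∑ f ∈ Icc 1 T, ((T - (3 * c + 2 * f) : ℕ) : ℤ) := by
    simp only [mul_left_comm _ (2 : ℤ), ← Finset.mul_sum]
    apply congrArg (HMul.hMul (2 : ℤ))
    refine Finset.sum_congr rfl fun c hd => Finset.sum_congr rfl fun d hf => ?_
    rw [Finset.mem_Icc] at hd hf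
    rw [pick T c (fun f => ((T - (2 * c + 2 * d + f) : ℕ) : ℤ)) (by omega) (by intro; omega)]
    congr 1; omega
  have t5 : ∑ c ∈ Icc 1 T, ∑ d ∈ Icc 1 T, ∑ f ∈ Icc 1 T,
      ((T - (2 * c + 2 * d + f) : ℕ) : ℤ) * (2 * (if f = d then 1 else 0)) =
      2 * ∑ c ∈ Icc 1 T, ∑ f ∈ Icc 1 T, ((T - (3 * c + 2 * f) : ℕ) : ℤ) := by
    simp only [mul_left_comm _ (2 : ℤ), ← Finset.mul_sum]
    apply congrArg (HMul.hMul (2 : ℤ))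
    rw [Finset.sum_comm]
    refine Finset.sum_congr rfl fun c hd => Finset.sum_congr rfl fun d hf => ?_
    rw [Finset.mem_Icc] at hd hf
    rw [pick T c (fun f => ((T - (2 * d + 2 * c + f) : ℕ) : ℤ)) (by omega) (by intro; omega)]
    congr 1; omega
  have t6 : ∑ c ∈ Icc 1 T, ∑ d ∈ Icc 1 T, ∑ f ∈ Icc 1 T,
      ((T - (2 * c + 2 * d + f) : ℕ) : ℤ) * (2 * (if c = d then 1 else 0)) =
      2 * ∑ c ∈ Icc 1 T, ∑ f ∈ Icc 1 T, ((T - (4 * c + f) : ℕ) : ℤ) := by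
    simp only [mul_left_comm _ (2 : ℤ), ← Finset.mul_sum]
    apply congrArg (HMul.hMul (2 : ℤ))
    rw [Finset.sum_comm]
    refine Finset.sum_congr rfl fun d hd => ?_
    rw [Finset.sum_comm]
    refine Finset.sum_congr rfl fun f hf => ?_
    rw [Finset.mem_Icc] at hd hf
    rw [pick T d (fun c => ((T - (2 * c + 2 * d + f) : ℕ) : ℤ)) (by omega) (by intro; omega)]
    congr 1; omega
  have t7 : ∑ c ∈ Icc 1 T, ∑ d ∈ Icc 1 T, ∑ f ∈ Icc 1 T,
      ((T - (2 * c + 2 * d + f) : ℕ) : ℤ) * (2 * (if c = d ∧ f = c then 1 else 0)) =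
      2 * ∑ c ∈ Icc 1 T, ((T - 5 * c : ℕ) : ℤ) := by
    simp only [mul_left_comm _ (2 : ℤ), ← Finset.mul_sum]
    apply congrArg (HMul.hMul (2 : ℤ))
    refine Finset.sum_congr rfl fun c hc => ?_
    rw [Finset.mem_Icc] at hc
    have : ∀ d ∈ Icc 1 T, ∑ f ∈ Icc 1 T,
        ((T - (2 * c + 2 * d + f) : ℕ) : ℤ) * (if c = d ∧ f = c then 1 else 0) =
        ((T - (2 * c + 2 * d + c) : ℕ) : ℤ) * (if d = c then 1 else 0) := by
      intro d hd
      rw [Finset.mem_Icc] at hd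
      by_cases h : d = c
      · subst h
        simp only [true_and, if_true, mul_one]
        rw [pick T d (fun f => ((T - (2 * d + 2 * d + f) : ℕ) : ℤ)) (by omega) (by intro; omega)]
      · have h' : ¬ c = d := fun e => h e.symm
        simp [h, h']
    rw [Finset.sum_congr rfl this]
    rw [pick T c (fun d => ((T - (2 * c + 2 * d + c) : ℕ) : ℤ)) (by omega) (by intro; omega)]
    congr 1; omega
  rw [t1, t2, t3, t4, t5, t6, t7]
  ring

lemma finalQ (k : ℕ) (hk : 0 < k) : 120 * (36 * ((QQ (60 * k - 1)).card : ℤ)) =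
      36*(60 * (k : ℤ))^5 - 1125*(60 * (k : ℤ))^4 + 13240*(60 * (k : ℤ))^3
        - 71868*(60 * (k : ℤ))^2 + 175680*(60 * (k : ℤ)) - 155520 := by
  rw [totalQ]
  have h1 := Smain k hk
  have h2 := S43 k hk
  have h3 := S33 k hk
  have h4 := S32 k hk
  have h5 := S41 k hk
  have h6 := S5 k hk
  generalize (∑ c ∈ Icc 1 (60 * k - 1), ∑ d ∈ Icc 1 (60 * k - 1), ∑ f ∈ Icc 1 (60 * k - 1),
      ((60 * k - 1 - (2 * c + 2 * d + f) : ℕ) : ℤ) * (c + d + f - 7)) = x1 at *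
  generalize (∑ c ∈ Icc 1 (60 * k - 1), ∑ f ∈ Icc 1 (60 * k - 1),
      ((60 * k - 1 - (4 * c + 3 * f) : ℕ) : ℤ)) = x2 at *
  generalize (∑ c ∈ Icc 1 (60 * k - 1), ∑ f ∈ Icc 1 (60 * k - 1),
      ((60 * k - 1 - (3 * c + 3 * f) : ℕ) : ℤ)) = x3 at *
  generalize (∑ c ∈ Icc 1 (60 * k - 1), ∑ f ∈ Icc 1 (60 * k - 1),
      ((60 * k - 1 - (3 * c + 2 * f) : ℕ) : ℤ)) = x4 at *
  generalize (∑ c ∈ Icc 1 (60 * k - 1), ∑ f ∈ Icc 1 (60 * k - 1),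
      ((60 * k - 1 - (4 * c + f) : ℕ) : ℤ)) = x5 at *
  generalize (∑ c ∈ Icc 1 (60 * k - 1), ((60 * k - 1 - 5 * c : ℕ) : ℤ)) = x6 at *
  linear_combination 144 * h1 + 8640 * h2 + 4320 * h3 + 17280 * h4 + 2880 * h5 - 8640 * h6

def vecP (x : ℕ × ℕ × ℕ × ℕ × ℕ) : Fin 3 → ℤ :=
  ![(x.2.2.2.2 : ℤ), x.2.2.2.2 + x.2.2.1, x.2.2.2.2 + x.2.2.1 + x.2.2.2.1]

def vecR (x : ℕ × ℕ × ℕ × ℕ × ℕ) : Fin 3 → ℤ :=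
  ![0, (x.1 : ℤ), (x.1 : ℤ) + x.2.1]

def PhiM (z : (Equiv.Perm (Fin 3) × Equiv.Perm (Fin 3)) × (ℕ × ℕ × ℕ × ℕ × ℕ)) :
    Matrix (Fin 3) (Fin 3) ℤ :=
  fun i j => vecP z.2 (z.1.1 (i + j)) + vecR z.2 (z.1.2 (i - j))

lemma perm_id : ∀ ρ : Equiv.Perm (Fin 3), (∀ i j, i < j → ρ i < ρ j) → ρ = 1 := by decide

lemma sm3 (f : Fin 3 → ℤ) (h1 : f 0 < f 1) (h2 : f 1 < f 2) : StrictMono f := by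
  rw [Fin.strictMono_iff_lt_succ]
  intro i
  fin_cases i
  · exact h1
  · exact h2

lemma uniq (f g : Fin 3 → ℤ) (hf : StrictMono f) (hg : StrictMono g) (σ τ : Equiv.Perm (Fin 3))
    (k : ℤ) (h : ∀ i, f (σ i) = g (τ i) + k) : σ = τ ∧ ∀ i, f i = g i + k := by
  have h1 : ∀ i, f i = g ((τ * σ⁻¹) i) + k := by
    intro i
    have := h (σ⁻¹ i)
    simpa using this
  have h2 : τ * σ⁻¹ = 1 := by
    apply perm_id
    intro i j hij
    have := hf hij
    rw [h1 i, h1 j] at this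
    exact hg.lt_iff_lt.1 (by linarith)
  refine ⟨(mul_inv_eq_one.1 h2).symm, fun i => ?_⟩
  rw [h1 i, h2]; rfl

lemma solve_ij : ∀ k l : Fin 3, ∃ i j : Fin 3, i + j = k ∧ i - j = l := by decide

lemma inj_ij : ∀ i j i' j' : Fin 3, i + j = i' + j' → i - j = i' - j' → i = i' ∧ j = j' := by decide

lemma memQ (T : ℕ) (x : ℕ × ℕ × ℕ × ℕ × ℕ) : x ∈ QQ T ↔
    1 ≤ x.1 ∧ 1 ≤ x.2.1 ∧ 1 ≤ x.2.2.1 ∧ 1 ≤ x.2.2.2.1 ∧ 1 ≤ x.2.2.2.2 ∧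
      Good x.2.2.1 x.2.2.2.1 x.1 x.2.1 ∧
      x.2.2.2.2 + (x.2.2.1 + x.2.2.2.1 + x.1 + x.2.1) ≤ T := by
  rw [QQ, Finset.mem_filter]
  simp only [Finset.mem_product, Finset.mem_Icc]
  constructor
  · rintro ⟨h, h1, h2⟩
    refine ⟨?_, ?_, ?_, ?_, ?_, h1, h2⟩ <;> omega
  · rintro ⟨_, _, _, _, _, h1, h2⟩
    refine ⟨?_, h1, h2⟩
    omega

lemma smP (x : ℕ × ℕ × ℕ × ℕ × ℕ) (h1 : 1 ≤ x.2.2.1) (h2 : 1 ≤ x.2.2.2.1) :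
    StrictMono (vecP x) := by
  apply sm3 <;> simp [vecP] <;> omega

lemma smR (x : ℕ × ℕ × ℕ × ℕ × ℕ) (h1 : 1 ≤ x.1) (h2 : 1 ≤ x.2.1) :
    StrictMono (vecR x) := by
  apply sm3 <;> simp [vecR] <;> omega

lemma phi_inj (T : ℕ) : Set.InjOn PhiM {z | z.2 ∈ QQ T} := by
  rintro ⟨⟨σ, τ⟩, x⟩ hx ⟨⟨σ', τ'⟩, x'⟩ hx' h
  simp only [Set.mem_setOf_eq, memQ] at hx hx'
  have key : ∀ k l, vecP x (σ k) + vecR x (τ l) = vecP x' (σ' k) + vecR x' (τ' l) := by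
    intro k l
    obtain ⟨i, j, rfl, rfl⟩ := solve_ij k l
    exact congrFun (congrFun h i) j
  obtain ⟨e1, e2⟩ := uniq (vecP x) (vecP x') (smP x hx.2.2.1 hx.2.2.2.1)
    (smP x' hx'.2.2.1 hx'.2.2.2.1) σ σ' (vecR x' (τ' 0) - vecR x (τ 0))
    (fun k => by linarith [key k 0])
  obtain ⟨e3, e4⟩ := uniq (vecR x) (vecR x') (smR x hx.1 hx.2.1)
    (smR x' hx'.1 hx'.2.1) τ τ' (vecP x' (σ' 0) - vecP x (σ 0))
    (fun k => by linarith [key 0 k])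
  have e5 := key 0 0
  have r0 := e4 0
  have r1 := e4 1
  have r2 := e4 2
  have p0 := e2 0
  have p1 := e2 1
  have p2 := e2 2
  have huv : vecR x' (τ' 0) - vecR x (τ 0) = - (vecP x' (σ' 0) - vecP x (σ 0)) := by linarith
  generalize vecR x' (τ' 0) - vecR x (τ 0) = u at *
  generalize vecP x' (σ' 0) - vecP x (σ 0) = v at *
  subst e1 e3
  obtain ⟨c, d, a, b, y⟩ := x
  obtain ⟨c', d', a', b', y'⟩ := x'
  simp [vecR, vecP] at r0 r1 r2 p0 p1 p2
  simp only [Prod.mk.injEq]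
  refine ⟨trivial, ?_, ?_, ?_, ?_, ?_⟩ <;> omega

lemma phi_mem (t : ℕ) (z : (Equiv.Perm (Fin 3) × Equiv.Perm (Fin 3)) × (ℕ × ℕ × ℕ × ℕ × ℕ))
    (hz : z.2 ∈ QQ (t - 1)) :
    IsSemimagicSq (PhiM z) ∧ ∀ i j, PhiM z i j < (t : ℤ) := by
  obtain ⟨⟨σ, τ⟩, x⟩ := z
  rw [memQ] at hz
  obtain ⟨h1, h2, h3, h4, h5, hG, hT⟩ := hz
  have mP := (smP x h3 h4).monotone
  have mR := (smR x h1 h2).monotone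
  have lo : ∀ k l, 0 < vecP x k + vecR x l := by
    intro k l
    have a1 := mP (Fin.zero_le k)
    have a2 := mR (Fin.zero_le l)
    simp [vecP] at a1
    simp [vecR] at a2
    simp only [vecP, vecR]
    simp only at h5
    omega
  have hi : ∀ k l, vecP x k + vecR x l < t := by
    intro k l
    have a1 := mP (Fin.le_last k)
    have a2 := mR (Fin.le_last l)
    simp [vecP] at a1
    simp [vecR] at a2
    simp only [vecP, vecR]
    simp only at h5 hT
    omega
  have inj : ∀ k l k' l', vecP x k + vecR x l = vecP x k' + vecR x l' → k = k' ∧ l = l' := by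
    intro k l k' l' h
    simp only [Good] at h1 h2 h3 h4 h5 hG
    fin_cases k <;> fin_cases l <;> fin_cases k' <;> fin_cases l' <;>
      simp [vecP, vecR] at h ⊢ <;> omega
  refine ⟨⟨fun i j => lo _ _, ?_, (∑ k, vecP x k) + ∑ l, vecR x l, ?_, ?_⟩, fun i j => hi _ _⟩
  · rintro ⟨i, j⟩ ⟨i', j'⟩ h
    obtain ⟨e1, e2⟩ := inj _ _ _ _ h
    obtain ⟨e3, e4⟩ := inj_ij i j i' j' (σ.injective e1) (τ.injective e2)
    rw [e3, e4]
  · intro i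
    simp only [PhiM, Finset.sum_add_distrib]
    congr 1
    · exact Equiv.sum_comp ((Equiv.addLeft i).trans σ) (vecP x)
    · exact Equiv.sum_comp ((Equiv.subLeft i).trans τ) (vecR x)
  · intro j
    simp only [PhiM, Finset.sum_add_distrib]
    congr 1
    · exact Equiv.sum_comp ((Equiv.addRight j).trans σ) (vecP x)
    · exact Equiv.sum_comp ((Equiv.subRight j).trans τ) (vecR x)

lemma decomp (x : Matrix (Fin 3) (Fin 3) ℤ) (s : ℤ) (hr : ∀ i, ∑ j, x i j = s)
    (hc : ∀ j, ∑ i, x i j = s) (i j : Fin 3) :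
    x i j = x (-(i + j)) (-(i + j)) + (x (-(i - j)) (i - j) - x 0 0) := by
  have r0 := hr 0
  have r1 := hr 1
  have r2 := hr 2
  have c0 := hc 0
  have c1 := hc 1
  have c2 := hc 2
  simp only [Fin.sum_univ_three] at r0 r1 r2 c0 c1 c2
  fin_cases i <;> fin_cases j <;> simp <;>
  (try rw [show (-1 : Fin 3) = 2 from rfl]) <;> (try rw [show (-2 : Fin 3) = 1 from rfl]) <;>
  (try rw [show (1 + 2 : Fin 3) = 0 from rfl]) <;> (try rw [show (2 + 1 : Fin 3) = 0 from rfl]) <;>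
  (try rw [show (1 + 1 : Fin 3) = 2 from rfl]) <;> (try rw [show (2 + 2 : Fin 3) = 1 from rfl]) <;>
  linarith

lemma phi_surj (t : ℕ) (x : Matrix (Fin 3) (Fin 3) ℤ) (hx : IsSemimagicSq x)
    (hxt : ∀ i j, x i j < (t : ℤ)) : ∃ z, z.2 ∈ QQ (t - 1) ∧ PhiM z = x := by
  obtain ⟨hpos, hinj, s, hr, hc⟩ := hx
  have hd := decomp x s hr hc
  obtain ⟨p, hp⟩ : ∃ p : Fin 3 → ℤ, ∀ k, p k = x (-k) (-k) := ⟨_, fun k => rfl⟩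
  obtain ⟨q, hq⟩ : ∃ q : Fin 3 → ℤ, ∀ l, q l = x (-l) l - x 0 0 := ⟨_, fun k => rfl⟩
  have hpq : ∀ i j, x i j = p (i + j) + q (i - j) := by
    intro i j; rw [hp, hq]; exact hd i j
  have hinj' : ∀ k l k' l', p k + q l = p k' + q l' → k = k' ∧ l = l' := by
    intro k l k' l' h
    obtain ⟨i, j, rfl, rfl⟩ := solve_ij k l
    obtain ⟨i', j', rfl, rfl⟩ := solve_ij k' l'
    rw [← hpq, ← hpq] at h
    have := @hinj (i, j) (i', j') h
    simp only [Prod.mk.injEq] at this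
    rw [this.1, this.2]
    exact ⟨rfl, rfl⟩
  have hlo : ∀ k l, 0 < p k + q l := by
    intro k l
    obtain ⟨i, j, rfl, rfl⟩ := solve_ij k l
    rw [← hpq]; exact hpos _ _
  have hhi : ∀ k l, p k + q l < t := by
    intro k l
    obtain ⟨i, j, rfl, rfl⟩ := solve_ij k l
    rw [← hpq]; exact hxt _ _
  have pinj : Function.Injective p := fun k k' h => (hinj' k 0 k' 0 (by rw [h])).1
  have qinj : Function.Injective q := fun k k' h => (hinj' 0 k 0 k' (by rw [h])).2
  obtain ⟨σ, hσ⟩ : ∃ σ : Equiv.Perm (Fin 3), StrictMono (p ∘ σ) :=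
    ⟨Tuple.sort p, (Tuple.monotone_sort p).strictMono_of_injective
      (pinj.comp (Equiv.injective _))⟩
  obtain ⟨τ, hτ⟩ : ∃ τ : Equiv.Perm (Fin 3), StrictMono (q ∘ τ) :=
    ⟨Tuple.sort q, (Tuple.monotone_sort q).strictMono_of_injective
      (qinj.comp (Equiv.injective _))⟩
  have P01 : p (σ 0) < p (σ 1) := hσ (by decide)
  have P12 : p (σ 1) < p (σ 2) := hσ (by decide)
  have R01 : q (τ 0) < q (τ 1) := hτ (by decide)
  have R12 : q (τ 1) < q (τ 2) := hτ (by decide)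
  have ne : ∀ k l k' l', (k, l) ≠ (k', l') → p (σ k) + q (τ l) ≠ p (σ k') + q (τ l') := by
    intro k l k' l' h h'
    obtain ⟨e1, e2⟩ := hinj' _ _ _ _ h'
    exact h (by rw [σ.injective e1, τ.injective e2])
  obtain ⟨y, hy⟩ := Int.eq_ofNat_of_zero_le (hlo (σ 0) (τ 0)).le
  obtain ⟨a, ha⟩ := Int.eq_ofNat_of_zero_le (sub_nonneg.2 P01.le)
  obtain ⟨b, hb⟩ := Int.eq_ofNat_of_zero_le (sub_nonneg.2 P12.le)
  obtain ⟨c, hc'⟩ := Int.eq_ofNat_of_zero_le (sub_nonneg.2 R01.le)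
  obtain ⟨d, hd'⟩ := Int.eq_ofNat_of_zero_le (sub_nonneg.2 R12.le)
  refine ⟨((σ⁻¹, τ⁻¹), (c, d, a, b, y)), ?_, ?_⟩
  · rw [memQ]
    simp only [Good]
    have l0 := hlo (σ 0) (τ 0)
    have l1 := hhi (σ 2) (τ 2)
    have n1 := ne 1 0 0 1 (by decide)
    have n2 := ne 1 1 0 2 (by decide)
    have n3 := ne 2 0 1 1 (by decide)
    have n4 := ne 2 1 1 2 (by decide)
    have n5 := ne 2 0 0 1 (by decide)
    have n6 := ne 2 1 0 2 (by decide)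
    have n7 := ne 1 0 0 2 (by decide)
    have n8 := ne 2 0 1 2 (by decide)
    have n9 := ne 2 0 0 2 (by decide)
    refine ⟨?_, ?_, ?_, ?_, ?_, ⟨?_, ?_, ?_, ?_, ?_, ?_, ?_, ?_, ?_⟩, ?_⟩ <;> omega
  · have eP : ∀ k, vecP (c, d, a, b, y) k = p (σ k) + q (τ 0) := by
      intro k
      fin_cases k <;> simp [vecP] <;> omega
    have eR : ∀ k, vecR (c, d, a, b, y) k = q (τ k) - q (τ 0) := by
      intro k
      fin_cases k <;> simp [vecR] <;> omega
    ext i j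
    rw [hpq]
    simp only [PhiM, eP, eR]
    simp

lemma ScQ (t : ℕ) : Sc t = 36 * (QQ (t - 1)).card := by
  have : {x : Matrix (Fin 3) (Fin 3) ℤ | IsSemimagicSq x ∧ ∀ i j, x i j < (t : ℤ)} =
      PhiM '' {z | z.2 ∈ QQ (t - 1)} := by
    ext x
    constructor
    · rintro ⟨h1, h2⟩
      obtain ⟨z, hz, e⟩ := phi_surj t x h1 h2
      exact ⟨z, hz, e⟩
    · rintro ⟨z, hz, rfl⟩
      exact phi_mem t z hz
  rw [Sc, this, Set.ncard_image_of_injOn (phi_inj _)]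
  have h2 : {z : (Equiv.Perm (Fin 3) × Equiv.Perm (Fin 3)) × (ℕ × ℕ × ℕ × ℕ × ℕ) |
      z.2 ∈ QQ (t - 1)} = (((Finset.univ ×ˢ QQ (t - 1)) : Finset ((Equiv.Perm (Fin 3) × Equiv.Perm (Fin 3)) ×
        (ℕ × ℕ × ℕ × ℕ × ℕ))) : Set _) := by
    ext z
    simp
  rw [h2, Set.ncard_coe_finset, Finset.card_product, Finset.card_univ, Fintype.card_prod,
    Fintype.card_perm]
  rfl

theorem semimagic_cubic_principal (t : ℕ) (ht : 0 < t) (hdvd : 60 ∣ t) :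
    120 * (Sc t : ℤ) =
      36*(t : ℤ)^5 - 1125*(t : ℤ)^4 + 13240*(t : ℤ)^3
        - 71868*(t : ℤ)^2 + 175680*(t : ℤ) - 155520 := by
  obtain ⟨k, rfl⟩ := hdvd
  rw [ScQ]
  have := finalQ k (by omega)
  push_cast
  exact this
end

section
/- Let S_a(t) denote the number of 3×3 semimagic squares with magic sum t. Then for every positive integer t divisible by 840, 280·S_a(t) = 35t⁴ − 1260t³ + 17010t² − 111168t + 362880. -/
/-- `Sa t` = number of 3×3 semimagic squares (positive entries, all nine
entries distinct, all row and column sums equal) with magic sum t. -/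
noncomputable def Sa (t : ℕ) : ℕ :=
  {x : Matrix (Fin 3) (Fin 3) ℤ |
    (∀ i j, 0 < x i j) ∧
    (Function.Injective fun p : Fin 3 × Fin 3 => x p.1 p.2) ∧
    (∀ i, ∑ j, x i j = (t : ℤ)) ∧ (∀ j, ∑ i, x i j = (t : ℤ))}.ncard

set_option linter.unusedSimpArgs false


def BB (n : ℕ) : Finset (ℕ × ℕ × ℕ) :=
  (Finset.range (3*n) ×ˢ Finset.range (3*n) ×ˢ Finset.range (3*n)).filter
    (fun x => 0 < x.2.2 ∧ x.2.2 < x.2.1 ∧ x.2.1 < x.1 ∧ 2 * x.1 < 3 * n)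

lemma mem_BB (n q p g : ℕ) : (q, p, g) ∈ BB n ↔ 0 < g ∧ g < p ∧ p < q ∧ 2 * q < 3 * n := by
  simp only [BB, Finset.mem_filter, Finset.mem_product, Finset.mem_range]
  omega

abbrev cA (_n : ℕ) (x : ℕ × ℕ × ℕ) : Prop := 2 * x.2.2 = x.2.1
abbrev cB (_n : ℕ) (x : ℕ × ℕ × ℕ) : Prop := 2 * x.2.2 = x.1
abbrev cC (_n : ℕ) (x : ℕ × ℕ × ℕ) : Prop := x.2.2 + x.2.1 = x.1
abbrev cD (n : ℕ) (x : ℕ × ℕ × ℕ) : Prop := x.2.2 + 3 * n = 2 * x.2.1 + x.1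
abbrev cE (n : ℕ) (x : ℕ × ℕ × ℕ) : Prop := x.2.2 + 3 * n = x.2.1 + 2 * x.1
abbrev cF (n : ℕ) (x : ℕ × ℕ × ℕ) : Prop := 2 * x.2.2 + 3 * n = 2 * x.2.1 + x.1
abbrev cG (n : ℕ) (x : ℕ × ℕ × ℕ) : Prop := 2 * x.2.2 + 3 * n = x.2.1 + 2 * x.1

abbrev good (n : ℕ) (x : ℕ × ℕ × ℕ) : Prop :=
  ¬ cA n x ∧ ¬ cB n x ∧ ¬ cC n x ∧ ¬ cD n x ∧ ¬ cE n x ∧ ¬ cF n x ∧ ¬ cG n x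

def RR (n : ℕ) : Finset (ℕ × ℕ × ℕ) := (BB n).filter (good n)

set_option maxHeartbeats 2000000 in
lemma pointwise (n : ℕ) (x : ℕ × ℕ × ℕ) (hx : x ∈ BB n) :
    (if good n x then 1 else 0 : ℤ) + (if cA n x then 1 else 0) + (if cB n x then 1 else 0)
     + (if cC n x then 1 else 0) + (if cD n x then 1 else 0) + (if cE n x then 1 else 0)
     + (if cF n x then 1 else 0) + (if cG n x then 1 else 0)
     + (if cA n x ∧ cC n x ∧ cE n x then 1 else 0) =
    1 + (if cA n x ∧ cC n x then 1 else 0) + (if cA n x ∧ cD n x then 1 else 0)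
      + (if cA n x ∧ cE n x then 1 else 0) + (if cB n x ∧ cD n x then 1 else 0)
      + (if cB n x ∧ cE n x then 1 else 0) + (if cC n x ∧ cE n x then 1 else 0)
      + (if cC n x ∧ cF n x then 1 else 0) + 2 * (if cD n x ∧ cG n x then 1 else 0) := by
  obtain ⟨q, p, g⟩ := x
  rw [mem_BB] at hx
  obtain ⟨h1, h2, h3, h4⟩ := hx
  unfold good cA cB cC cD cE cF cG
  dsimp only
  by_cases hA : 2 * g = p <;> by_cases hB : 2 * g = q <;> try (exfalso; omega)
  all_goals by_cases hC : g + p = q <;> try (exfalso; omega)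
  all_goals by_cases hD : g + 3 * n = 2 * p + q <;> try (exfalso; omega)
  all_goals by_cases hE : g + 3 * n = p + 2 * q <;> try (exfalso; omega)
  all_goals by_cases hF : 2 * g + 3 * n = 2 * p + q <;> try (exfalso; omega)
  all_goals by_cases hG : 2 * g + 3 * n = p + 2 * q <;> try (exfalso; omega)
  all_goals first | replace hA := eq_false hA | replace hA := eq_true hA
  all_goals first | replace hB := eq_false hB | replace hB := eq_true hB
  all_goals first | replace hC := eq_false hC | replace hC := eq_true hC
  all_goals first | replace hD := eq_false hD | replace hD := eq_true hD
  all_goals first | replace hE := eq_false hE | replace hE := eq_true hE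
  all_goals first | replace hF := eq_false hF | replace hF := eq_true hF
  all_goals first | replace hG := eq_false hG | replace hG := eq_true hG
  all_goals simp only [hA, hB, hC, hD, hE, hF, hG]
  all_goals norm_num

lemma incl_excl (n : ℕ) :
    ((RR n).card : ℤ) + ((BB n).filter (cA n)).card + ((BB n).filter (cB n)).card
     + ((BB n).filter (cC n)).card + ((BB n).filter (cD n)).card + ((BB n).filter (cE n)).card
     + ((BB n).filter (cF n)).card + ((BB n).filter (cG n)).card
     + ((BB n).filter (fun x => cA n x ∧ cC n x ∧ cE n x)).card =
    (BB n).card + ((BB n).filter (fun x => cA n x ∧ cC n x)).card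
      + ((BB n).filter (fun x => cA n x ∧ cD n x)).card
      + ((BB n).filter (fun x => cA n x ∧ cE n x)).card
      + ((BB n).filter (fun x => cB n x ∧ cD n x)).card
      + ((BB n).filter (fun x => cB n x ∧ cE n x)).card
      + ((BB n).filter (fun x => cC n x ∧ cE n x)).card
      + ((BB n).filter (fun x => cC n x ∧ cF n x)).card
      + 2 * ((BB n).filter (fun x => cD n x ∧ cG n x)).card := by
  have h := Finset.sum_congr (rfl : BB n = BB n) (pointwise n)
  simp only [Finset.sum_add_distrib, ← Finset.mul_sum, Finset.sum_boole] at h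
  rw [Finset.sum_const] at h
  simpa [RR] using h

lemma card_T (n : ℕ) (hn : 0 < n) : (BB n).card =
    ∑ q ∈ Finset.range ((3*n-1)/2+1), ∑ p ∈ Finset.range q, (p - 1) := by
  have : (BB n).card = ((Finset.range ((3*n-1)/2+1)).sigma
      (fun q => (Finset.range q).sigma (fun p => Finset.Ico 1 p))).card := by
    apply Finset.card_nbij' (fun x => ⟨x.1, x.2.1, x.2.2⟩) (fun y => (y.1, y.2.1, y.2.2))
    · rintro ⟨q, p, g⟩ h
      simp [mem_BB, cA, cB, cC, cD, cE, cF, cG] at h ⊢; omega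
    · rintro ⟨q, p, g⟩ h
      simp [mem_BB, cA, cB, cC, cD, cE, cF, cG] at h ⊢; omega
    · rintro ⟨q, p, g⟩ h; rfl
    · rintro ⟨q, p, g⟩ h; rfl
  rw [this]; simp [Finset.card_sigma]

lemma card_A (n : ℕ) (hn : 0 < n) : ((BB n).filter (cA n)).card =
    ∑ q ∈ Finset.range ((3*n-1)/2+1), ((q+1)/2 - 1) := by
  have : ((BB n).filter (cA n)).card = ((Finset.range ((3*n-1)/2+1)).sigma
      (fun q => Finset.Ico 1 ((q+1)/2))).card := by
    apply Finset.card_nbij' (fun x => ⟨x.1, x.2.2⟩) (fun y => (y.1, 2 * y.2, y.2))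
    · rintro ⟨q, p, g⟩ h
      simp [mem_BB, cA, cB, cC, cD, cE, cF, cG] at h ⊢; omega
    · rintro ⟨q, g⟩ h
      simp [mem_BB, cA, cB, cC, cD, cE, cF, cG] at h ⊢; omega
    · rintro ⟨q, p, g⟩ h
      simp [mem_BB, cA, cB, cC, cD, cE, cF, cG] at h ⊢; omega
    · rintro ⟨q, g⟩ h; rfl
  rw [this]; simp [Finset.card_sigma]

lemma card_C (n : ℕ) (hn : 0 < n) : ((BB n).filter (cC n)).card =
    ∑ q ∈ Finset.range ((3*n-1)/2+1), ((q+1)/2 - 1) := by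
  have : ((BB n).filter (cC n)).card = ((Finset.range ((3*n-1)/2+1)).sigma
      (fun q => Finset.Ico 1 ((q+1)/2))).card := by
    apply Finset.card_nbij' (fun x => ⟨x.1, x.2.2⟩) (fun y => (y.1, y.1 - y.2, y.2))
    · rintro ⟨q, p, g⟩ h
      simp [mem_BB, cA, cB, cC, cD, cE, cF, cG] at h ⊢; omega
    · rintro ⟨q, g⟩ h
      simp [mem_BB, cA, cB, cC, cD, cE, cF, cG] at h ⊢; omega
    · rintro ⟨q, p, g⟩ h
      simp [mem_BB, cA, cB, cC, cD, cE, cF, cG] at h ⊢; omega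
    · rintro ⟨q, g⟩ h; rfl
  rw [this]; simp [Finset.card_sigma]

lemma card_B (n : ℕ) (hn : 0 < n) : ((BB n).filter (cB n)).card =
    ∑ g ∈ Finset.range ((3*n-1)/2/2+1), (g - 1) := by
  have : ((BB n).filter (cB n)).card = ((Finset.range ((3*n-1)/2/2+1)).sigma
      (fun g => Finset.Ioo g (2*g))).card := by
    apply Finset.card_nbij' (fun x => ⟨x.2.2, x.2.1⟩) (fun y => (2*y.1, y.2, y.1))
    · rintro ⟨q, p, g⟩ h
      simp [mem_BB, cA, cB, cC, cD, cE, cF, cG] at h ⊢; omega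
    · rintro ⟨g, p⟩ h
      simp [mem_BB, cA, cB, cC, cD, cE, cF, cG] at h ⊢; omega
    · rintro ⟨q, p, g⟩ h
      simp [mem_BB, cA, cB, cC, cD, cE, cF, cG] at h ⊢; omega
    · rintro ⟨q, g⟩ h; rfl
  rw [this]; simp only [Finset.card_sigma, Nat.card_Ioo]
  apply Finset.sum_congr rfl; intros; omega

lemma card_D (n : ℕ) (hn : 0 < n) : ((BB n).filter (cD n)).card =
    ∑ j ∈ Finset.range ((n-1)/2+1), ((3*j+1)/2 - 1) := by
  have : ((BB n).filter (cD n)).card = ((Finset.range ((n-1)/2+1)).sigma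
      (fun j => Finset.Ioo ((2*n-j)/2) (n+j))).card := by
    apply Finset.card_nbij' (fun x => ⟨x.1 - n, x.2.1⟩)
      (fun y => (n+y.1, y.2, 2*y.2+y.1-2*n))
    · rintro ⟨q, p, g⟩ h
      simp [mem_BB, cA, cB, cC, cD, cE, cF, cG] at h ⊢; omega
    · rintro ⟨g, p⟩ h
      simp [mem_BB, cA, cB, cC, cD, cE, cF, cG] at h ⊢; omega
    · rintro ⟨q, p, g⟩ h
      simp [mem_BB, cA, cB, cC, cD, cE, cF, cG] at h ⊢; omega
    · rintro ⟨q, g⟩ h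
      simp
  rw [this]; simp only [Finset.card_sigma, Nat.card_Ioo]
  apply Finset.sum_congr rfl; intro j hj; rw [Finset.mem_range] at hj; omega

lemma card_E (n : ℕ) (hn : 0 < n) : ((BB n).filter (cE n)).card =
    ∑ j ∈ Finset.range ((n-1)/2+1), (3*j - 1) := by
  have : ((BB n).filter (cE n)).card = ((Finset.range ((n-1)/2+1)).sigma
      (fun j => Finset.Ioo (n-2*j) (n+j))).card := by
    apply Finset.card_nbij' (fun x => ⟨x.1 - n, x.2.1⟩)
      (fun y => (n+y.1, y.2, y.2+2*y.1-n))
    · rintro ⟨q, p, g⟩ h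
      simp [mem_BB, cA, cB, cC, cD, cE, cF, cG] at h ⊢; omega
    · rintro ⟨g, p⟩ h
      simp [mem_BB, cA, cB, cC, cD, cE, cF, cG] at h ⊢; omega
    · rintro ⟨q, p, g⟩ h
      simp [mem_BB, cA, cB, cC, cD, cE, cF, cG] at h ⊢; omega
    · rintro ⟨q, g⟩ h
      simp
  rw [this]; simp only [Finset.card_sigma, Nat.card_Ioo]
  apply Finset.sum_congr rfl; intro j hj; rw [Finset.mem_range] at hj; omega

lemma card_F (n : ℕ) (hn : 0 < n) : ((BB n).filter (cF n)).card =
    ∑ j ∈ Finset.range ((n-1)/2/2+1), (3*j - 1) := by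
  have : ((BB n).filter (cF n)).card = ((Finset.range ((n-1)/2/2+1)).sigma
      (fun j => Finset.Ico 1 (3*j))).card := by
    apply Finset.card_nbij' (fun x => ⟨(x.1 - n)/2, x.2.2⟩)
      (fun y => (n+2*y.1, n+y.2-y.1, y.2))
    · rintro ⟨q, p, g⟩ h
      simp [mem_BB, cA, cB, cC, cD, cE, cF, cG] at h ⊢; omega
    · rintro ⟨g, p⟩ h
      simp [mem_BB, cA, cB, cC, cD, cE, cF, cG] at h ⊢; omega
    · rintro ⟨q, p, g⟩ h
      simp [mem_BB, cA, cB, cC, cD, cE, cF, cG] at h ⊢; omega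
    · rintro ⟨q, g⟩ h
      simp
  rw [this]; simp [Finset.card_sigma]

lemma card_G (n : ℕ) (hn : 0 < n) : ((BB n).filter (cG n)).card =
    ∑ j ∈ Finset.range ((n-1)/2+1), ((3*j+1)/2 - 1) := by
  have : ((BB n).filter (cG n)).card = ((Finset.range ((n-1)/2+1)).sigma
      (fun j => Finset.Ico 1 ((3*j+1)/2))).card := by
    apply Finset.card_nbij' (fun x => ⟨x.1 - n, x.2.2⟩)
      (fun y => (n+y.1, n+2*y.2-2*y.1, y.2))
    · rintro ⟨q, p, g⟩ h
      simp [mem_BB, cA, cB, cC, cD, cE, cF, cG] at h ⊢; omega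
    · rintro ⟨g, p⟩ h
      simp [mem_BB, cA, cB, cC, cD, cE, cF, cG] at h ⊢; omega
    · rintro ⟨q, p, g⟩ h
      simp [mem_BB, cA, cB, cC, cD, cE, cF, cG] at h ⊢; omega
    · rintro ⟨q, g⟩ h
      simp
  rw [this]; simp [Finset.card_sigma]
lemma card_AC (n : ℕ) (hn : 0 < n) : ((BB n).filter (fun x => cA n x ∧ cC n x)).card =
    (n+1)/2 - (1) := by
  have : ((BB n).filter (fun x => cA n x ∧ cC n x)).card = (Finset.Ico (1) ((n+1)/2)).card := by
    apply Finset.card_nbij' (fun x => x.2.2) (fun y => (3*y,2*y,y))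
    · rintro ⟨q, p, g⟩ h
      simp [mem_BB, cA, cB, cC, cD, cE, cF, cG] at h ⊢; omega
    · rintro y h
      simp [mem_BB, cA, cB, cC, cD, cE, cF, cG] at h ⊢; omega
    · rintro ⟨q, p, g⟩ h
      simp [mem_BB, cA, cB, cC, cD, cE, cF, cG] at h ⊢; omega
    · rintro y h; rfl
  rw [this, Nat.card_Ico]

lemma card_AD (n : ℕ) (hn : 0 < n) : ((BB n).filter (fun x => cA n x ∧ cD n x)).card =
    (3*n+4)/5 - (n/2+1) := by
  have : ((BB n).filter (fun x => cA n x ∧ cD n x)).card = (Finset.Ico (n/2+1) ((3*n+4)/5)).card := by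
    apply Finset.card_nbij' (fun x => x.2.2) (fun y => (3*n-3*y,2*y,y))
    · rintro ⟨q, p, g⟩ h
      simp [mem_BB, cA, cB, cC, cD, cE, cF, cG] at h ⊢; omega
    · rintro y h
      simp [mem_BB, cA, cB, cC, cD, cE, cF, cG] at h ⊢; omega
    · rintro ⟨q, p, g⟩ h
      simp [mem_BB, cA, cB, cC, cD, cE, cF, cG] at h ⊢; omega
    · rintro y h; rfl
  rw [this, Nat.card_Ico]

lemma card_AE (n : ℕ) (hn : 0 < n) : ((BB n).filter (fun x => cA n x ∧ cE n x)).card =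
    (3*n+1)/2 - (6*n/5+1) := by
  have : ((BB n).filter (fun x => cA n x ∧ cE n x)).card = (Finset.Ico (6*n/5+1) ((3*n+1)/2)).card := by
    apply Finset.card_nbij' (fun x => x.1) (fun y => (y,6*n-4*y,3*n-2*y))
    · rintro ⟨q, p, g⟩ h
      simp [mem_BB, cA, cB, cC, cD, cE, cF, cG] at h ⊢; omega
    · rintro y h
      simp [mem_BB, cA, cB, cC, cD, cE, cF, cG] at h ⊢; omega
    · rintro ⟨q, p, g⟩ h
      simp [mem_BB, cA, cB, cC, cD, cE, cF, cG] at h ⊢; omega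
    · rintro y h; rfl
  rw [this, Nat.card_Ico]

lemma card_BD (n : ℕ) (hn : 0 < n) : ((BB n).filter (fun x => cB n x ∧ cD n x)).card =
    (6*n+4)/5 - (9*n/8+1) := by
  have : ((BB n).filter (fun x => cB n x ∧ cD n x)).card = (Finset.Ico (9*n/8+1) ((6*n+4)/5)).card := by
    apply Finset.card_nbij' (fun x => x.2.1) (fun y => (6*n-4*y,y,3*n-2*y))
    · rintro ⟨q, p, g⟩ h
      simp [mem_BB, cA, cB, cC, cD, cE, cF, cG] at h ⊢; omega
    · rintro y h
      simp [mem_BB, cA, cB, cC, cD, cE, cF, cG] at h ⊢; omega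
    · rintro ⟨q, p, g⟩ h
      simp [mem_BB, cA, cB, cC, cD, cE, cF, cG] at h ⊢; omega
    · rintro y h; rfl
  rw [this, Nat.card_Ico]

lemma card_BE (n : ℕ) (hn : 0 < n) : ((BB n).filter (fun x => cB n x ∧ cE n x)).card =
    (3*n+3)/4 - (3*n/5+1) := by
  have : ((BB n).filter (fun x => cB n x ∧ cE n x)).card = (Finset.Ico (3*n/5+1) ((3*n+3)/4)).card := by
    apply Finset.card_nbij' (fun x => x.2.2) (fun y => (2*y,3*n-3*y,y))
    · rintro ⟨q, p, g⟩ h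
      simp [mem_BB, cA, cB, cC, cD, cE, cF, cG] at h ⊢; omega
    · rintro y h
      simp [mem_BB, cA, cB, cC, cD, cE, cF, cG] at h ⊢; omega
    · rintro ⟨q, p, g⟩ h
      simp [mem_BB, cA, cB, cC, cD, cE, cF, cG] at h ⊢; omega
    · rintro y h; rfl
  rw [this, Nat.card_Ico]

lemma card_CE (n : ℕ) (hn : 0 < n) : ((BB n).filter (fun x => cC n x ∧ cE n x)).card =
    n - (3*n/4+1) := by
  have : ((BB n).filter (fun x => cC n x ∧ cE n x)).card = (Finset.Ico (3*n/4+1) (n)).card := by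
    apply Finset.card_nbij' (fun x => x.2.1) (fun y => (3*n-2*y,y,3*n-3*y))
    · rintro ⟨q, p, g⟩ h
      simp [mem_BB, cA, cB, cC, cD, cE, cF, cG] at h ⊢; omega
    · rintro y h
      simp [mem_BB, cA, cB, cC, cD, cE, cF, cG] at h ⊢; omega
    · rintro ⟨q, p, g⟩ h
      simp [mem_BB, cA, cB, cC, cD, cE, cF, cG] at h ⊢; omega
    · rintro y h; rfl
  rw [this, Nat.card_Ico]

lemma card_CF (n : ℕ) (hn : 0 < n) : ((BB n).filter (fun x => cC n x ∧ cF n x)).card =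
    (9*n+7)/8 - (n+1) := by
  have : ((BB n).filter (fun x => cC n x ∧ cF n x)).card = (Finset.Ico (n+1) ((9*n+7)/8)).card := by
    apply Finset.card_nbij' (fun x => x.2.1) (fun y => (4*y-3*n,y,3*y-3*n))
    · rintro ⟨q, p, g⟩ h
      simp [mem_BB, cA, cB, cC, cD, cE, cF, cG] at h ⊢; omega
    · rintro y h
      simp [mem_BB, cA, cB, cC, cD, cE, cF, cG] at h ⊢; omega
    · rintro ⟨q, p, g⟩ h
      simp [mem_BB, cA, cB, cC, cD, cE, cF, cG] at h ⊢; omega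
    · rintro y h; rfl
  rw [this, Nat.card_Ico]

lemma card_DG (n : ℕ) (hn : 0 < n) : ((BB n).filter (fun x => cD n x ∧ cG n x)).card =
    (3*n+1)/2 - (n+1) := by
  have : ((BB n).filter (fun x => cD n x ∧ cG n x)).card = (Finset.Ico (n+1) ((3*n+1)/2)).card := by
    apply Finset.card_nbij' (fun x => x.1) (fun y => (y,n,y-n))
    · rintro ⟨q, p, g⟩ h
      simp [mem_BB, cA, cB, cC, cD, cE, cF, cG] at h ⊢; omega
    · rintro y h
      simp [mem_BB, cA, cB, cC, cD, cE, cF, cG] at h ⊢; omega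
    · rintro ⟨q, p, g⟩ h
      simp [mem_BB, cA, cB, cC, cD, cE, cF, cG] at h ⊢; omega
    · rintro y h; rfl
  rw [this, Nat.card_Ico]

lemma card_ACE (n : ℕ) (hn : 0 < n) : ((BB n).filter (fun x => cA n x ∧ cC n x ∧ cE n x)).card =
    3*n/7+1 - ((3*n+6)/7) := by
  have : ((BB n).filter (fun x => cA n x ∧ cC n x ∧ cE n x)).card = (Finset.Ico ((3*n+6)/7) (3*n/7+1)).card := by
    apply Finset.card_nbij' (fun x => x.2.2) (fun y => (3*y,2*y,y))
    · rintro ⟨q, p, g⟩ h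
      simp [mem_BB, cA, cB, cC, cD, cE, cF, cG] at h ⊢; omega
    · rintro y h
      simp [mem_BB, cA, cB, cC, cD, cE, cF, cG] at h ⊢; omega
    · rintro ⟨q, p, g⟩ h
      simp [mem_BB, cA, cB, cC, cD, cE, cF, cG] at h ⊢; omega
    · rintro y h; rfl
  rw [this, Nat.card_Ico]


lemma ce (c d e n : ℕ) (h : (c = 3 ∧ d = 5 ∧ e = 4) ∨ (c = 3 ∧ d = 4 ∧ e = 3) ∨
    (c = 9 ∧ d = 8 ∧ e = 7) ∨ (c = 6 ∧ d = 5 ∧ e = 4) ∨ (c = 3 ∧ d = 7 ∧ e = 6)) :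
    (((c*n+e)/d : ℕ) : ℤ) = (c*n/d : ℕ) + 1 - (if d ∣ n then 1 else 0) := by
  have h1 := Nat.div_add_mod n d
  have h2 : n % d < d := Nat.mod_lt _ (by omega)
  generalize n / d = a at *
  generalize n % d = r at *
  subst h1
  rcases h with ⟨rfl, rfl, rfl⟩ | ⟨rfl, rfl, rfl⟩ | ⟨rfl, rfl, rfl⟩ | ⟨rfl, rfl, rfl⟩ | ⟨rfl, rfl, rfl⟩
  all_goals interval_cases r <;> split_ifs <;> omega

lemma pairs_sum (n : ℕ) (hn : 0 < n) :
    (((BB n).filter (fun x => cA n x ∧ cC n x)).card : ℤ)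
      + ((BB n).filter (fun x => cA n x ∧ cD n x)).card
      + ((BB n).filter (fun x => cA n x ∧ cE n x)).card
      + ((BB n).filter (fun x => cB n x ∧ cD n x)).card
      + ((BB n).filter (fun x => cB n x ∧ cE n x)).card
      + ((BB n).filter (fun x => cC n x ∧ cE n x)).card
      + ((BB n).filter (fun x => cC n x ∧ cF n x)).card
      + 2 * ((BB n).filter (fun x => cD n x ∧ cG n x)).card
      - ((BB n).filter (fun x => cA n x ∧ cC n x ∧ cE n x)).card
    = 5 * ((n-1)/2 : ℕ) - 2 * (if 5 ∣ n then 1 else 0) - (if 4 ∣ n then 1 else 0)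
      - (if 8 ∣ n then 1 else 0) - (if 7 ∣ n then 1 else 0) := by
  rw [card_AC n hn, card_AD n hn, card_AE n hn, card_BD n hn, card_BE n hn, card_CE n hn,
    card_CF n hn, card_DG n hn, card_ACE n hn]
  have k1 : (((3*n+4)/5 : ℕ) : ℤ) = (3*n/5 : ℕ) + 1 - (if 5 ∣ n then 1 else 0) := ce _ _ _ n (by simp)
  have k2 : (((3*n+3)/4 : ℕ) : ℤ) = (3*n/4 : ℕ) + 1 - (if 4 ∣ n then 1 else 0) := ce _ _ _ n (by simp)
  have k3 : (((9*n+7)/8 : ℕ) : ℤ) = (9*n/8 : ℕ) + 1 - (if 8 ∣ n then 1 else 0) := ce _ _ _ n (by simp)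
  have k4 : (((6*n+4)/5 : ℕ) : ℤ) = (6*n/5 : ℕ) + 1 - (if 5 ∣ n then 1 else 0) := ce _ _ _ n (by simp)
  have k5 : (((n-1)/2 : ℕ) : ℤ) = n - 1 - (n/2 : ℕ) := by omega
  have k6 : (((n-1)/2 : ℕ) : ℤ) = ((3*n+1)/2 : ℕ) - 1 - n := by omega
  have h1 : (((3*n+4)/5 - (n/2+1) : ℕ) : ℤ) + ((3*n+3)/4 - (3*n/5+1) : ℕ) + (n - (3*n/4+1) : ℕ)
      = ((n-1)/2 : ℕ) - (if 5 ∣ n then 1 else 0) - (if 4 ∣ n then 1 else 0) := by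
    rw [Nat.cast_sub (by omega), Nat.cast_sub (by omega), Nat.cast_sub (by omega), k1, k2, k5]
    push_cast; ring
  have h2 : (((9*n+7)/8 - (n+1) : ℕ) : ℤ) + ((6*n+4)/5 - (9*n/8+1) : ℕ)
       + ((3*n+1)/2 - (6*n/5+1) : ℕ)
      = ((n-1)/2 : ℕ) - (if 5 ∣ n then 1 else 0) - (if 8 ∣ n then 1 else 0) := by
    rw [Nat.cast_sub (by omega), Nat.cast_sub (by omega), Nat.cast_sub (by omega), k3, k4, k6]
    push_cast; ring
  have h3 : ((3*n/7+1 - ((3*n+6)/7) : ℕ) : ℤ) = (if 7 ∣ n then 1 else 0) := by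
    have := ce 3 7 6 n (by simp)
    rw [Nat.cast_sub (by omega)]; push_cast at this ⊢; linarith
  have h4 : (3*n+1)/2 - (n+1) = (n-1)/2 := by omega
  have h5 : (n+1)/2 - 1 = (n-1)/2 := by omega
  rw [h4, h5, h3]
  linarith

lemma sT (M : ℕ) : 6 * ((∑ q ∈ Finset.range (M+1), ∑ p ∈ Finset.range q, (p - 1) : ℕ) : ℤ)
    = M * (M-1) * (M-2) := by
  have h1 : ∀ q : ℕ, 2 * ((∑ p ∈ Finset.range (q+1), (p - 1) : ℕ) : ℤ) = q * (q - 1) := by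
    intro q
    induction q with
    | zero => simp
    | succ k ih => rw [Finset.sum_range_succ]; push_cast at ih ⊢; simp; linarith
  induction M with
  | zero => simp
  | succ k ih =>
    rw [Finset.sum_range_succ]; have := h1 k; push_cast at ih this ⊢; linarith

lemma sB (M : ℕ) : 2 * ((∑ p ∈ Finset.range (M+1), (p - 1) : ℕ) : ℤ) = M * (M - 1) := by
  induction M with
  | zero => simp
  | succ k ih => rw [Finset.sum_range_succ]; push_cast at ih ⊢; simp; linarith

lemma sE (M : ℕ) : 2 * ((∑ j ∈ Finset.range (M+1), (3 * j - 1) : ℕ) : ℤ) = M * (3 * M + 1) := by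
  induction M with
  | zero => simp
  | succ k ih =>
    rw [Finset.sum_range_succ]
    have : ((3 * (k+1) - 1 : ℕ) : ℤ) = 3 * k + 2 := by omega
    rw [Nat.cast_add, this]; push_cast at ih ⊢; linarith

lemma sA (u : ℕ) : ((∑ q ∈ Finset.range (2*u+1), ((q+1)/2 - 1) : ℕ) : ℤ) = u * (u - 1) := by
  induction u with
  | zero => simp
  | succ k ih =>
    rw [show 2*(k+1)+1 = 2*k+1+1+1 by ring, Finset.sum_range_succ, Finset.sum_range_succ]
    have h1 : (2*k+1+1)/2 - 1 = k := by omega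
    have h2 : (2*k+1+1+1)/2 - 1 = k := by omega
    rw [h1, h2]; push_cast at ih ⊢; linarith

lemma sA1 (u : ℕ) : ((∑ q ∈ Finset.range (2*u+1+1), ((q+1)/2 - 1) : ℕ) : ℤ) = u * u := by
  rw [Finset.sum_range_succ]
  have h1 : (2*u+1+1)/2 - 1 = u := by omega
  rw [h1, Nat.cast_add, sA]; ring

lemma sD (a : ℕ) : ((∑ j ∈ Finset.range (2*a+1), ((3*j+1)/2 - 1) : ℕ) : ℤ) = 3 * a * a := by
  induction a with
  | zero => simp
  | succ k ih =>
    rw [show 2*(k+1)+1 = 2*k+1+1+1 by ring, Finset.sum_range_succ, Finset.sum_range_succ]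
    have h1 : (3*(2*k+1)+1)/2 - 1 = 3*k+1 := by omega
    have h2 : (3*(2*k+1+1)+1)/2 - 1 = 3*k+2 := by omega
    rw [h1, h2]; push_cast at ih ⊢; linarith

lemma sD1 (a : ℕ) : ((∑ j ∈ Finset.range (2*a+1+1), ((3*j+1)/2 - 1) : ℕ) : ℤ)
    = 3 * a * a + 3 * a + 1 := by
  rw [Finset.sum_range_succ]
  have h1 : (3*(2*a+1)+1)/2 - 1 = 3*a+1 := by omega
  rw [h1, Nat.cast_add, sD]; push_cast; ring

/-- indicator part -/
def ind (n : ℕ) : ℤ := 2 * (if 5 ∣ n then 1 else 0) + (if 4 ∣ n then 1 else 0)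
      + (if 8 ∣ n then 1 else 0) + (if 7 ∣ n then 1 else 0)

lemma RR_formula (n : ℕ) (hn : 0 < n) : ((RR n).card : ℤ) + ind n =
    (∑ q ∈ Finset.range ((3*n-1)/2+1), ∑ p ∈ Finset.range q, (p - 1) : ℕ)
    - 2 * (∑ q ∈ Finset.range ((3*n-1)/2+1), ((q+1)/2 - 1) : ℕ)
    - (∑ g ∈ Finset.range ((3*n-1)/2/2+1), (g - 1) : ℕ)
    - 2 * (∑ j ∈ Finset.range ((n-1)/2+1), ((3*j+1)/2 - 1) : ℕ)
    - (∑ j ∈ Finset.range ((n-1)/2+1), (3*j - 1) : ℕ)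
    - (∑ j ∈ Finset.range ((n-1)/2/2+1), (3*j - 1) : ℕ) + 5 * ((n-1)/2 : ℕ) := by
  have h1 := incl_excl n
  have h2 := pairs_sum n hn
  rw [card_T n hn, card_A n hn, card_B n hn, card_C n hn, card_D n hn, card_E n hn, card_F n hn,
    card_G n hn] at h1
  unfold ind
  linarith

lemma R1 (h : ℕ) : 6 * (((RR (4*h+1)).card : ℤ) + ind (4*h+1)) =
    (6*h+1)*(6*h)*(6*h-1) - 12*(3*h*(3*h)) - 3*(3*h*(3*h-1)) - 12 * (3*h*h) - 3*(2*h*(6*h+1))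
    - 3 * (h*(3*h+1)) + 30*(2*h) := by
  rw [RR_formula _ (by omega)]
  have e1 : (3*(4*h+1)-1)/2 = 6*h+1 := by omega
  have e2 : (6*h+1)/2 = 3*h := by omega
  have e3 : (4*h+1-1)/2 = 2*h := by omega
  have e4 : 2*h/2 = h := by omega
  rw [e1, e2, e3, e4]
  have a1 := sT (6*h+1)
  have a2 := sA1 (3*h)
  have a3 := sB (3*h)
  have a4 := sD h
  have a5 := sE (2*h)
  have a6 := sE h
  rw [show 2*(3*h) = 6*h by ring] at a2
  push_cast at *
  linarith

lemma R2 (h : ℕ) : 6 * (((RR (4*h+2)).card : ℤ) + ind (4*h+2)) =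
    (6*h+2)*(6*h+1)*(6*h) - 12*((3*h+1)*(3*h)) - 3*((3*h+1)*(3*h)) - 12 * (3*h*h)
    - 3*(2*h*(6*h+1)) - 3 * (h*(3*h+1)) + 30*(2*h) := by
  rw [RR_formula _ (by omega)]
  have e1 : (3*(4*h+2)-1)/2 = 6*h+2 := by omega
  have e2 : (6*h+2)/2 = 3*h+1 := by omega
  have e3 : (4*h+2-1)/2 = 2*h := by omega
  have e4 : 2*h/2 = h := by omega
  rw [e1, e2, e3, e4]
  have a1 := sT (6*h+2)
  have a2 := sA (3*h+1)
  have a3 := sB (3*h+1)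
  have a4 := sD h
  have a5 := sE (2*h)
  have a6 := sE h
  rw [show 2*(3*h+1) = 6*h+2 by ring] at a2
  push_cast at *
  linarith

lemma R3 (h : ℕ) : 6 * (((RR (4*h+3)).card : ℤ) + ind (4*h+3)) =
    (6*h+4)*(6*h+3)*(6*h+2) - 12*((3*h+2)*(3*h+1)) - 3*((3*h+2)*(3*h+1)) - 12 * (3*h*h+3*h+1)
    - 3*((2*h+1)*(6*h+4)) - 3 * (h*(3*h+1)) + 30*(2*h+1) := by
  rw [RR_formula _ (by omega)]
  have e1 : (3*(4*h+3)-1)/2 = 6*h+4 := by omega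
  have e2 : (6*h+4)/2 = 3*h+2 := by omega
  have e3 : (4*h+3-1)/2 = 2*h+1 := by omega
  have e4 : (2*h+1)/2 = h := by omega
  rw [e1, e2, e3, e4]
  have a1 := sT (6*h+4)
  have a2 := sA (3*h+2)
  have a3 := sB (3*h+2)
  have a4 := sD1 h
  have a5 := sE (2*h+1)
  have a6 := sE h
  rw [show 2*(3*h+2) = 6*h+4 by ring] at a2
  push_cast at *
  linarith

lemma R4 (h : ℕ) : 6 * (((RR (4*h+4)).card : ℤ) + ind (4*h+4)) =
    (6*h+5)*(6*h+4)*(6*h+3) - 12*((3*h+2)*(3*h+2)) - 3*((3*h+2)*(3*h+1)) - 12 * (3*h*h+3*h+1)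
    - 3*((2*h+1)*(6*h+4)) - 3 * (h*(3*h+1)) + 30*(2*h+1) := by
  rw [RR_formula _ (by omega)]
  have e1 : (3*(4*h+4)-1)/2 = 6*h+5 := by omega
  have e2 : (6*h+5)/2 = 3*h+2 := by omega
  have e3 : (4*h+4-1)/2 = 2*h+1 := by omega
  have e4 : (2*h+1)/2 = h := by omega
  rw [e1, e2, e3, e4]
  have a1 := sT (6*h+5)
  have a2 := sA1 (3*h+2)
  have a3 := sB (3*h+2)
  have a4 := sD1 h
  have a5 := sE (2*h+1)
  have a6 := sE h
  rw [show 2*(3*h+2)+1 = 6*h+5 by ring] at a2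
  push_cast at *
  linarith

lemma ind_sum (k : ℕ) : ∑ n ∈ Finset.range (280*k), ind (n+1) = 257 * k := by
  induction k with
  | zero => simp
  | succ k ih =>
    rw [show 280*(k+1) = 280*k+280 by ring, Finset.sum_range_add, ih]
    have : ∀ x ∈ Finset.range 280, ind (280*k+x+1) = ind (x+1) := by
      intro x _
      unfold ind
      have h5 : 5 ∣ 280*k+x+1 ↔ 5 ∣ x+1 := by omega
      have h4 : 4 ∣ 280*k+x+1 ↔ 4 ∣ x+1 := by omega
      have h8 : 8 ∣ 280*k+x+1 ↔ 8 ∣ x+1 := by omega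
      have h7 : 7 ∣ 280*k+x+1 ↔ 7 ∣ x+1 := by omega
      simp only [h5, h4, h8, h7]
    rw [Finset.sum_congr rfl this]
    have : ∑ x ∈ Finset.range 280, ind (x+1) = 257 := by decide +kernel
    rw [this]; push_cast; ring

lemma tot (H : ℕ) : ∑ n ∈ Finset.range (4*H), 6 * (((RR (n+1)).card : ℤ) + ind (n+1)) =
    216*(H:ℤ)^4 - 432*(H:ℤ)^3 + 297*(H:ℤ)^2 - 69*(H:ℤ) := by
  induction H with
  | zero => simp
  | succ h ih =>
    rw [show 4*(h+1) = 4*h+1+1+1+1 by ring, Finset.sum_range_succ, Finset.sum_range_succ,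
      Finset.sum_range_succ, Finset.sum_range_succ, ih]
    have h1 := R1 h
    have h2 := R2 h
    have h3 := R3 h
    have h4 := R4 h
    rw [h1, show 4*h+1+1 = 4*h+2 by ring, h2, show 4*h+2+1 = 4*h+3 by ring, h3,
      show 4*h+3+1 = 4*h+4 by ring, h4]
    push_cast; ring

lemma RR_total (k : ℕ) (hk : 0 < k) :
    6 * ((∑ n ∈ Finset.range (280*k-1), (RR (n+1)).card : ℕ) : ℤ) =
    216*(70*k:ℤ)^4 - 432*(70*k:ℤ)^3 + 297*(70*k:ℤ)^2 - 69*(70*k:ℤ) - 6 * (257*k)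
     - ((420*k-1)*(420*k-2)*(420*k-3) - 12*((210*k-1)*(210*k-1)) - 3*((210*k-1)*(210*k-2))
      - 12 * (3*(70*k-1)*(70*k)+1)
    - 3*((140*k-1)*(420*k-2)) - 3 * ((70*k-1)*(210*k-2)) + 30*(140*k-1) - 30) := by
  have h1 := tot (70*k)
  rw [← Finset.mul_sum, Finset.sum_add_distrib, show 4*(70*k) = 280*k by ring, ind_sum] at h1
  obtain ⟨N, hN⟩ : ∃ N, 280*k = N+1 := ⟨280*k-1, by omega⟩
  have h2 := R4 (70*k-1)
  rw [show 4*(70*k-1)+4 = N+1 by omega, Nat.cast_sub (by omega)] at h2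
  have h3 : ind (N+1) = 5 := by
    rw [← hN]; unfold ind
    rw [if_pos (by omega), if_pos (by omega), if_pos (by omega), if_pos (by omega)]; norm_num
  rw [h3] at h2
  rw [hN, Finset.sum_range_succ] at h1
  rw [hN, Nat.add_sub_cancel]
  push_cast at h1 h2 ⊢
  linarith

abbrev MM := Matrix (Fin 3) (Fin 3) ℤ

def Sq (t : ℕ) : Set MM := {x : Matrix (Fin 3) (Fin 3) ℤ |
    (∀ i j, 0 < x i j) ∧
    (Function.Injective fun p : Fin 3 × Fin 3 => x p.1 p.2) ∧
    (∀ i, ∑ j, x i j = (t : ℤ)) ∧ (∀ j, ∑ i, x i j = (t : ℤ))}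

lemma Sq_finite (t : ℕ) : (Sq t).Finite := by
  apply (Set.finite_Icc (fun _ _ => 0 : Fin 3 → Fin 3 → ℤ) (fun _ _ => (t : ℤ))).subset
  rintro x ⟨h1, -, h3, -⟩
  refine ⟨fun i j => (h1 i j).le, fun i j => ?_⟩
  rw [← h3 i]
  exact Finset.single_le_sum (f := fun j => x i j) (fun j _ => (h1 i j).le) (Finset.mem_univ j)

lemma Sq_sub {t : ℕ} {x : MM} (hx : x ∈ Sq t) (σ τ : Equiv.Perm (Fin 3)) :
    x.submatrix σ τ ∈ Sq t := by
  obtain ⟨h1, h2, h3, h4⟩ := hx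
  refine ⟨fun i j => h1 _ _, ?_, fun i => ?_, fun j => ?_⟩
  · rintro ⟨i, j⟩ ⟨k, l⟩ h
    have := @h2 (σ i, τ j) (σ k, τ l) h
    simpa using this
  · rw [← h3 (σ i)]; exact Equiv.sum_comp τ (fun j => x (σ i) j)
  · rw [← h4 (τ j)]; exact Equiv.sum_comp σ (fun i => x i (τ j))

lemma Sq_tr {t : ℕ} {x : MM} (hx : x ∈ Sq t) : x.transpose ∈ Sq t := by
  obtain ⟨h1, h2, h3, h4⟩ := hx
  refine ⟨fun i j => h1 _ _, ?_, h4, h3⟩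
  rintro ⟨i, j⟩ ⟨k, l⟩ h
  have := @h2 (j, i) (l, k) h
  simp at this ⊢; tauto

noncomputable def X (t : ℕ) : Finset MM := (Sq_finite t).toFinset

lemma mem_X {t : ℕ} {x : MM} : x ∈ X t ↔ x ∈ Sq t := by simp [X]

def isMin (p : Fin 3 × Fin 3) (x : MM) : Prop := ∀ k l, (k, l) ≠ p → x p.1 p.2 < x k l

lemma exists_isMin {t : ℕ} {x : MM} (hx : x ∈ Sq t) : ∃! p, isMin p x := by
  obtain ⟨p, -, hp⟩ := Finset.exists_min_image (Finset.univ : Finset (Fin 3 × Fin 3))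
    (fun p => x p.1 p.2) ⟨(0, 0), Finset.mem_univ _⟩
  refine ⟨p, ?_, ?_⟩
  · intro k l h
    refine lt_of_le_of_ne (hp (k, l) (Finset.mem_univ _)) ?_
    intro he
    exact h (hx.2.1 (a₁ := (k, l)) (a₂ := p) he.symm)
  · intro p' hp'
    by_contra hne
    have := hp' p.1 p.2 (fun h => hne h.symm)
    have := hp p' (Finset.mem_univ _)
    omega

open Classical in
lemma card_X (t : ℕ) : (X t).card = 9 * ((X t).filter (isMin (0, 0))).card := by
  have h1 : (X t).card = ∑ p : Fin 3 × Fin 3, ((X t).filter (isMin p)).card := by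
    rw [← Finset.card_biUnion]
    · congr 1
      ext x
      simp only [Finset.mem_biUnion, Finset.mem_univ, true_and, Finset.mem_filter]
      constructor
      · intro h
        obtain ⟨p, hp, -⟩ := exists_isMin (mem_X.1 h)
        exact ⟨p, h, hp⟩
      · rintro ⟨p, h, -⟩; exact h
    · intro p _ p' _ hne
      change Disjoint _ _
      rw [Finset.disjoint_left]
      intro x hx hx'
      rw [Finset.mem_filter] at hx hx'
      exact hne ((exists_isMin (mem_X.1 hx.1)).unique hx.2 hx'.2)
  rw [h1]
  have h2 : ∀ p ∈ (Finset.univ : Finset (Fin 3 × Fin 3)),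
      ((X t).filter (isMin p)).card = ((X t).filter (isMin (0, 0))).card := by
    rintro ⟨i, j⟩ -
    apply Finset.card_nbij' (fun x => x.submatrix (Equiv.swap 0 i) (Equiv.swap 0 j))
      (fun x => x.submatrix (Equiv.swap 0 i) (Equiv.swap 0 j))
    · intro x hx
      simp only [Finset.coe_filter, Set.mem_ofPred_eq] at hx ⊢
      refine ⟨mem_X.2 (Sq_sub (mem_X.1 hx.1) _ _), ?_⟩
      intro k l hkl
      have := hx.2 (Equiv.swap 0 i k) (Equiv.swap 0 j l) (by
        intro h
        simp only [Prod.mk.injEq, Equiv.swap_apply_eq_iff, Equiv.swap_apply_right] at h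
        exact hkl (by rw [h.1, h.2]))
      simpa using this
    · intro x hx
      simp only [Finset.coe_filter, Set.mem_ofPred_eq] at hx ⊢
      refine ⟨mem_X.2 (Sq_sub (mem_X.1 hx.1) _ _), ?_⟩
      intro k l hkl
      have := hx.2 (Equiv.swap 0 i k) (Equiv.swap 0 j l) (by
        intro h
        simp only [Prod.mk.injEq, Equiv.swap_apply_eq_iff, Equiv.swap_apply_left] at h
        exact hkl (by rw [h.1, h.2]))
      simpa using this
    · intro x _; ext; simp
    · intro x _; ext; simp
  rw [Finset.sum_congr rfl h2]
  simp

lemma halve (S : Finset MM) (P : MM → Prop) [DecidablePred P] (f : MM → MM) (hf : ∀ x ∈ S, f x ∈ S)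
    (hi : ∀ x, f (f x) = x) (hP : ∀ x ∈ S, P (f x) ↔ ¬ P x) :
    S.card = 2 * (S.filter P).card := by
  have h1 := Finset.card_filter_add_card_filter_not (s := S) P
  have h2 : (S.filter (fun x => ¬ P x)).card = (S.filter P).card := by
    apply Finset.card_nbij' f f
    · intro x hx
      simp only [Finset.coe_filter, Set.mem_ofPred_eq] at hx ⊢
      exact ⟨hf x hx.1, (hP x hx.1).2 hx.2⟩
    · intro x hx
      simp only [Finset.coe_filter, Set.mem_ofPred_eq] at hx ⊢
      exact ⟨hf x hx.1, fun h => (hP x hx.1).1 h hx.2⟩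
    · intro x _; exact hi x
    · intro x _; exact hi x
  omega

lemma ne_of_Sq {t : ℕ} {x : MM} (hx : x ∈ Sq t) (i j k l : Fin 3) (h : (i, j) ≠ (k, l)) :
    x i j ≠ x k l := fun he => h (hx.2.1 (a₁ := (i, j)) (a₂ := (k, l)) he)

lemma isMin_iff (x : MM) : isMin (0, 0) x ↔ x 0 0 < x 0 1 ∧ x 0 0 < x 0 2 ∧ x 0 0 < x 1 0 ∧
    x 0 0 < x 1 1 ∧ x 0 0 < x 1 2 ∧ x 0 0 < x 2 0 ∧ x 0 0 < x 2 1 ∧ x 0 0 < x 2 2 := by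
  simp [isMin, Fin.forall_fin_succ]
  try tauto

open Classical in
noncomputable def Z (t : ℕ) : Finset MM :=
  ((((X t).filter (isMin (0, 0))).filter (fun x => x 0 1 < x 0 2)).filter
    (fun x => x 1 0 < x 2 0)).filter (fun x => x 0 1 < x 1 0)

lemma card_XZ (t : ℕ) : (X t).card = 72 * (Z t).card := by
  classical
  have s0 : (Equiv.swap (1 : Fin 3) 2) 0 = 0 := by decide
  have s1 : (Equiv.swap (1 : Fin 3) 2) 1 = 2 := by decide
  have s2 : (Equiv.swap (1 : Fin 3) 2) 2 = 1 := by decide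
  have h1 := halve ((X t).filter (isMin (0, 0))) (fun x => x 0 1 < x 0 2)
    (fun x => x.submatrix (1 : Equiv.Perm (Fin 3)) (Equiv.swap 1 2))
    (by
      intro x hx
      simp only [Finset.mem_filter, isMin_iff] at hx ⊢
      refine ⟨mem_X.2 (Sq_sub (mem_X.1 hx.1) _ _), ?_⟩
      simp [s0, s1, s2]; omega)
    (by intro x; ext; simp)
    (by
      intro x hx
      simp only [Finset.mem_filter] at hx
      have := ne_of_Sq (mem_X.1 hx.1) 0 1 0 2 (by decide)
      simp [s0, s1, s2]; omega)
  have h2 := halve (((X t).filter (isMin (0, 0))).filter (fun x => x 0 1 < x 0 2))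
    (fun x => x 1 0 < x 2 0)
    (fun x => x.submatrix (Equiv.swap 1 2) (1 : Equiv.Perm (Fin 3)))
    (by
      intro x hx
      simp only [Finset.mem_filter, isMin_iff] at hx ⊢
      refine ⟨⟨mem_X.2 (Sq_sub (mem_X.1 hx.1.1) _ _), ?_⟩, ?_⟩ <;>
      simp [s0, s1, s2] <;> omega)
    (by intro x; ext; simp)
    (by
      intro x hx
      simp only [Finset.mem_filter] at hx
      have := ne_of_Sq (mem_X.1 hx.1.1) 1 0 2 0 (by decide)
      simp [s0, s1, s2]; omega)
  have h3 := halve ((((X t).filter (isMin (0, 0))).filter (fun x => x 0 1 < x 0 2)).filter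
      (fun x => x 1 0 < x 2 0)) (fun x => x 0 1 < x 1 0)
    (fun x => x.transpose)
    (by
      intro x hx
      simp only [Finset.mem_filter, isMin_iff] at hx ⊢
      refine ⟨⟨⟨mem_X.2 (Sq_tr (mem_X.1 hx.1.1.1)), ?_⟩, ?_⟩, ?_⟩ <;>
      simp only [Matrix.transpose_apply] <;> omega)
    (by intro x; rfl)
    (by
      intro x hx
      simp only [Finset.mem_filter] at hx
      have := ne_of_Sq (mem_X.1 hx.1.1.1) 0 1 1 0 (by decide)
      simp only [Matrix.transpose_apply]; omega)
  have h0 := card_X t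
  have hz : (Z t).card = (((((X t).filter (isMin (0, 0))).filter (fun x => x 0 1 < x 0 2)).filter
    (fun x => x 1 0 < x 2 0)).filter (fun x => x 0 1 < x 1 0)).card := by
    unfold Z; congr!
  rw [hz]
  omega

def mk (N i q p g : ℕ) : MM :=
  !![(N - i - 1 : ℤ), N - i - 1 + p, N - i - 1 + 3 * (i + 1) - p;
     N - i - 1 + q, N - i - 1 + 3 * (i + 1) - p - q + g, N - i - 1 + p - g;
     N - i - 1 + 3 * (i + 1) - q, N - i - 1 + q - g, N - i - 1 + g]

lemma mk_mem (N i q p g : ℕ) (hi : i < N - 1) (hm : (q, p, g) ∈ RR (i+1)) :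
    mk N i q p g ∈ Sq (3*N) := by
  simp only [RR, Finset.mem_filter, mem_BB, good, cA, cB, cC, cD, cE, cF, cG] at hm
  obtain ⟨⟨b1, b2, b3, b4⟩, c1, c2, c3, c4, c5, c6, c7⟩ := hm
  refine ⟨?_, ?_, ?_, ?_⟩
  · intro a b
    fin_cases a <;> fin_cases b <;> simp [mk] <;> omega
  · rintro ⟨a, b⟩ ⟨c, d⟩ h
    by_contra hne
    fin_cases a <;> fin_cases b <;> fin_cases c <;> fin_cases d <;>
      first
      | exact hne rfl
      | (clear hne; simp [mk] at h; omega)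
  · intro a
    fin_cases a <;> simp [mk, Fin.sum_univ_three] <;> omega
  · intro a
    fin_cases a <;> simp [mk, Fin.sum_univ_three] <;> omega

lemma card_Z (N : ℕ) (hN : 0 < N) :
    (Z (3*N)).card = ∑ n ∈ Finset.range (N-1), (RR (n+1)).card := by
  rw [← Finset.card_sigma]
  symm
  apply Finset.card_nbij (fun y => mk N y.1 y.2.1 y.2.2.1 y.2.2.2)
  · rintro ⟨i, q, p, g⟩ h
    rw [Finset.mem_coe, Finset.mem_sigma, Finset.mem_range] at h
    have hm := mk_mem N i q p g h.1 h.2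
    have hm2 := h.2
    simp only [RR, Finset.mem_filter, mem_BB] at hm2
    have h1 := hm2.1
    simp only [Z, Finset.coe_filter, Set.mem_ofPred_eq, Finset.mem_filter, isMin_iff]
    refine ⟨⟨⟨⟨mem_X.2 hm, ?_⟩, ?_⟩, ?_⟩, ?_⟩ <;> clear hm hm2 <;> simp [mk] <;> omega
  · rintro ⟨i, q, p, g⟩ _ ⟨i', q', p', g'⟩ _ h
    dsimp only at h
    have e1 := congrFun (congrFun h 0) 0
    have e2 := congrFun (congrFun h 0) 1
    have e3 := congrFun (congrFun h 1) 0
    have e4 := congrFun (congrFun h 2) 2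
    simp [mk] at e1 e2 e3 e4
    obtain rfl : i = i' := by omega
    obtain rfl : q = q' := by omega
    obtain rfl : p = p' := by omega
    obtain rfl : g = g' := by omega
    rfl
  · intro x hx
    simp only [Z, Finset.coe_filter, Set.mem_ofPred_eq, Finset.mem_filter, isMin_iff] at hx
    obtain ⟨⟨⟨⟨hX, hmin⟩, h1⟩, h2⟩, h3⟩ := hx
    have hS := mem_X.1 hX
    have n1 := ne_of_Sq hS 1 2 2 2 (by decide)
    have n2 := ne_of_Sq hS 2 1 2 2 (by decide)
    have n3 := ne_of_Sq hS 2 1 0 1 (by decide)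
    have n4 := ne_of_Sq hS 1 1 0 1 (by decide)
    have n5 := ne_of_Sq hS 1 1 1 0 (by decide)
    have n6 := ne_of_Sq hS 1 1 1 2 (by decide)
    have n7 := ne_of_Sq hS 1 1 2 1 (by decide)
    obtain ⟨hpos, -, hr, hc⟩ := hS
    have p0 := hpos 0 0
    have r0 := hr 0
    have r1 := hr 1
    have r2 := hr 2
    have c0 := hc 0
    have c1 := hc 1
    have c2 := hc 2
    rw [Fin.sum_univ_three] at r0 r1 r2 c0 c1 c2
    push_cast at r0 r1 r2 c0 c1 c2
    clear hX hpos hr hc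
    obtain ⟨i, hi⟩ : ∃ i : ℕ, x 0 0 = N - i - 1 := ⟨(N - 1 - x 0 0).toNat, by omega⟩
    obtain ⟨p, hp⟩ : ∃ p : ℕ, x 0 1 = x 0 0 + p := ⟨(x 0 1 - x 0 0).toNat, by omega⟩
    obtain ⟨q, hq⟩ : ∃ q : ℕ, x 1 0 = x 0 0 + q := ⟨(x 1 0 - x 0 0).toNat, by omega⟩
    obtain ⟨g, hg⟩ : ∃ g : ℕ, x 2 2 = x 0 0 + g := ⟨(x 2 2 - x 0 0).toNat, by omega⟩
    have e02 : x 0 2 = N - i - 1 + 3 * (i + 1) - p := by omega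
    have e20 : x 2 0 = N - i - 1 + 3 * (i + 1) - q := by omega
    have e12 : x 1 2 = N - i - 1 + p - g := by omega
    have e21 : x 2 1 = N - i - 1 + q - g := by omega
    have e11 : x 1 1 = N - i - 1 + 3 * (i + 1) - p - q + g := by omega
    rw [hi] at hp hq hg
    rw [hi, hp, hq, hg, e02, e20, e12, e21, e11] at hmin
    rw [hp, e02] at h1
    rw [hq, e20] at h2
    rw [hp, hq] at h3
    rw [e12, hg] at n1
    rw [e21, hg] at n2
    rw [e21, hp] at n3
    rw [e11, hp] at n4
    rw [e11, hq] at n5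
    rw [e11, e12] at n6
    rw [e11, e21] at n7
    rw [hi] at p0
    refine ⟨⟨i, q, p, g⟩, ?_, ?_⟩
    · rw [Finset.mem_coe, Finset.mem_sigma, Finset.mem_range]
      clear r0 r1 r2 c0 c1 c2 e02 e20 e12 e21 e11 hi hp hq hg
      refine ⟨by dsimp only; omega, ?_⟩
      simp only [RR, Finset.mem_filter, mem_BB, good, cA, cB, cC, cD, cE, cF, cG]
      refine ⟨⟨?_, ?_, ?_, ?_⟩, ?_, ?_, ?_, ?_, ?_, ?_, ?_⟩ <;> omega
    · ext a b
      fin_cases a <;> fin_cases b <;> simp [mk, *]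

theorem semimagic_affine_principal (t : ℕ) (ht : 0 < t) (hdvd : 840 ∣ t) :
    280 * (Sa t : ℤ) =
      35*(t : ℤ)^4 - 1260*(t : ℤ)^3 + 17010*(t : ℤ)^2
        - 111168*(t : ℤ) + 362880 := by
  obtain ⟨k, rfl⟩ := hdvd
  have hk : 0 < k := by omega
  have h1 : Sa (840*k) = (X (840*k)).card := Set.ncard_eq_toFinset_card _ (Sq_finite (840*k))
  have h2 := RR_total k hk
  have h3 := card_Z (280*k) (by omega)
  rw [show 3*(280*k) = 840*k by ring] at h3
  rw [h1, card_XZ, h3, Nat.cast_mul]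
  push_cast at h2 ⊢
  linarith
end

section
/- Let L_c(t) denote the number of 3×3 magilatin squares all of whose entries lie strictly between 0 and t. Then for every positive integer t divisible by 60, 120·L_c(t) = 36t⁵ − 765t⁴ + 8080t³ − 45228t² + 119280t − 113760. -/
/-- A 3×3 magilatin square: positive entries, all row and column sums equal,
entries distinct within each row and within each column. -/
def IsMagilatinSq (x : Matrix (Fin 3) (Fin 3) ℤ) : Prop :=
  (∀ i j, 0 < x i j) ∧
  (∀ i, Function.Injective fun j => x i j) ∧
  (∀ j, Function.Injective fun i => x i j) ∧
  ∃ s : ℤ, (∀ i, ∑ j, x i j = s) ∧ (∀ j, ∑ i, x i j = s)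

/-- `Lc t` = number of 3×3 magilatin squares all of whose entries lie strictly
between 0 and t. -/
noncomputable def Lc (t : ℕ) : ℕ :=
  {x : Matrix (Fin 3) (Fin 3) ℤ |
    IsMagilatinSq x ∧ ∀ i j, x i j < (t : ℤ)}.ncard


theorem inj3 (f : Fin 3 → ℤ) : Function.Injective f ↔ f 0 ≠ f 1 ∧ f 0 ≠ f 2 ∧ f 1 ≠ f 2 := by
  constructor
  · intro h
    refine ⟨fun e => ?_, fun e => ?_, fun e => ?_⟩ <;> exact absurd (h e) (by decide)
  · rintro ⟨h1, h2, h3⟩ i j e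
    fin_cases i <;> fin_cases j <;> simp_all

theorem magi_iff (x : Matrix (Fin 3) (Fin 3) ℤ) (t : ℤ) :
    (IsMagilatinSq x ∧ ∀ i j, x i j < t) ↔
    ((0 < x 0 0 ∧ 0 < x 0 1 ∧ 0 < x 0 2 ∧ 0 < x 1 0 ∧ 0 < x 1 1 ∧ 0 < x 1 2 ∧
      0 < x 2 0 ∧ 0 < x 2 1 ∧ 0 < x 2 2) ∧
     (x 0 0 < t ∧ x 0 1 < t ∧ x 0 2 < t ∧ x 1 0 < t ∧ x 1 1 < t ∧ x 1 2 < t ∧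
      x 2 0 < t ∧ x 2 1 < t ∧ x 2 2 < t) ∧
     (x 1 0 + x 1 1 + x 1 2 = x 0 0 + x 0 1 + x 0 2 ∧
      x 2 0 + x 2 1 + x 2 2 = x 0 0 + x 0 1 + x 0 2 ∧
      x 0 0 + x 1 0 + x 2 0 = x 0 0 + x 0 1 + x 0 2 ∧
      x 0 1 + x 1 1 + x 2 1 = x 0 0 + x 0 1 + x 0 2 ∧
      x 0 2 + x 1 2 + x 2 2 = x 0 0 + x 0 1 + x 0 2) ∧
     ((x 0 0 ≠ x 0 1 ∧ x 0 0 ≠ x 0 2 ∧ x 0 1 ≠ x 0 2) ∧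
      (x 1 0 ≠ x 1 1 ∧ x 1 0 ≠ x 1 2 ∧ x 1 1 ≠ x 1 2) ∧
      (x 2 0 ≠ x 2 1 ∧ x 2 0 ≠ x 2 2 ∧ x 2 1 ≠ x 2 2) ∧
      (x 0 0 ≠ x 1 0 ∧ x 0 0 ≠ x 2 0 ∧ x 1 0 ≠ x 2 0) ∧
      (x 0 1 ≠ x 1 1 ∧ x 0 1 ≠ x 2 1 ∧ x 1 1 ≠ x 2 1) ∧
      (x 0 2 ≠ x 1 2 ∧ x 0 2 ≠ x 2 2 ∧ x 1 2 ≠ x 2 2))) := by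
  unfold IsMagilatinSq
  simp only [inj3, Fin.forall_fin_succ, Fin.sum_univ_three, Fin.succ_zero_eq_one,
    Fin.succ_one_eq_two, IsEmpty.forall_iff, and_true]
  constructor
  · rintro ⟨⟨h1, h2, h3, s, h4, h5⟩, h6⟩
    refine ⟨by simpa only [and_assoc] using h1, by simpa only [and_assoc] using h6, ?_, ?_⟩
    · clear h1 h2 h3 h6
      obtain ⟨h7, h8, h9⟩ := h4
      obtain ⟨k7, k8, k9⟩ := h5
      subst h7
      exact ⟨h8, h9, k7, k8, k9⟩
    · simpa only [and_assoc] using And.intro h2 h3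
  · rintro ⟨h1, h2, h3, h4⟩
    refine ⟨⟨by tauto, by tauto, by tauto, _, ⟨rfl, ?_, ?_⟩, ?_, ?_, ?_⟩, by tauto⟩ <;> tauto

abbrev T3 := ℕ × ℕ × ℕ
def mx (a : T3) : ℕ := max a.1 (max a.2.1 a.2.2)
def md (a : T3) : ℕ := a.1 + a.2.1 + a.2.2 - mx a
def TT (t : ℕ) : Finset T3 :=
  (Finset.range t ×ˢ Finset.range t ×ˢ Finset.range t).filter
    (fun a => a.1 = 0 ∨ a.2.1 = 0 ∨ a.2.2 = 0)

def dis (p m u n : ℕ) : Prop :=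
  p ≠ u ∧ p + u ≠ n ∧ p ≠ n ∧ m ≠ p + u ∧ m + u ≠ n + p ∧ m ≠ p + n ∧ m ≠ u ∧ m + u ≠ n ∧ m ≠ n
instance (p m u n : ℕ) : Decidable (dis p m u n) := by unfold dis; infer_instance

def phi (z : T3 × T3 × ℕ) : Matrix (Fin 3) (Fin 3) ℤ :=
  !![(z.1.1 + z.2.1.1 + z.2.2 + 1 : ℤ), z.1.2.1 + z.2.1.2.1 + z.2.2 + 1,
        z.1.2.2 + z.2.1.2.2 + z.2.2 + 1;
     z.1.2.2 + z.2.1.2.1 + z.2.2 + 1, z.1.1 + z.2.1.2.2 + z.2.2 + 1,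
        z.1.2.1 + z.2.1.1 + z.2.2 + 1;
     z.1.2.1 + z.2.1.2.2 + z.2.2 + 1, z.1.2.2 + z.2.1.1 + z.2.2 + 1,
        z.1.1 + z.2.1.2.1 + z.2.2 + 1]

def DD (t : ℕ) : Finset (T3 × T3 × ℕ) :=
  (TT t ×ˢ TT t ×ˢ Finset.range t).filter
    (fun z => dis (md z.1) (mx z.1) (md z.2.1) (mx z.2.1) ∧ z.2.2 < t - 1 - mx z.1 - mx z.2.1)

/-- triples up to order -/
theorem cases3 (a0 a1 a2 : ℕ) (h : a0 = 0 ∨ a1 = 0 ∨ a2 = 0) :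
   ∃ p m, p ≤ m ∧ md (a0,a1,a2) = p ∧ mx (a0,a1,a2) = m ∧
    ((a0 = 0 ∧ a1 = p ∧ a2 = m) ∨ (a0 = 0 ∧ a1 = m ∧ a2 = p) ∨ (a0 = p ∧ a1 = 0 ∧ a2 = m) ∨
     (a0 = m ∧ a1 = 0 ∧ a2 = p) ∨ (a0 = p ∧ a1 = m ∧ a2 = 0) ∨ (a0 = m ∧ a1 = p ∧ a2 = 0)) := by
  refine ⟨_, _, ?_, rfl, rfl, ?_⟩ <;> simp only [md, mx] <;> omega

theorem absset {a0 a1 a2 p m : ℕ} (hpm : p ≤ m) (h :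
    ((a0 = 0 ∧ a1 = p ∧ a2 = m) ∨ (a0 = 0 ∧ a1 = m ∧ a2 = p) ∨ (a0 = p ∧ a1 = 0 ∧ a2 = m) ∨
     (a0 = m ∧ a1 = 0 ∧ a2 = p) ∨ (a0 = p ∧ a1 = m ∧ a2 = 0) ∨ (a0 = m ∧ a1 = p ∧ a2 = 0))) (x : ℕ) :
    (x = ((a0:ℤ)-a1).natAbs ∨ x = ((a0:ℤ)-a2).natAbs ∨ x = ((a1:ℤ)-a2).natAbs) ↔
      (x = p ∨ x = m - p ∨ x = m) := by
  rcases h with ⟨rfl, rfl, rfl⟩ | ⟨rfl, rfl, rfl⟩ | ⟨rfl, rfl, rfl⟩ | ⟨rfl, rfl, rfl⟩ |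
    ⟨rfl, rfl, rfl⟩ | ⟨rfl, rfl, rfl⟩
  · rw [show ((0:ℕ):ℤ) - (a1:ℤ) = -(a1:ℤ) by simp, show ((0:ℕ):ℤ) - (a2:ℤ) = -(a2:ℤ) by simp,
      Int.natAbs_neg, Int.natAbs_neg, Int.natAbs_natCast, Int.natAbs_natCast,
      show ((a1:ℤ)-a2).natAbs = a2 - a1 by omega]
    tauto
  · rw [show ((0:ℕ):ℤ) - (a1:ℤ) = -(a1:ℤ) by simp, show ((0:ℕ):ℤ) - (a2:ℤ) = -(a2:ℤ) by simp,
      Int.natAbs_neg, Int.natAbs_neg, Int.natAbs_natCast, Int.natAbs_natCast,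
      show ((a1:ℤ)-a2).natAbs = a1 - a2 by omega]
    tauto
  · rw [show ((a0:ℤ) - (0:ℕ)).natAbs = a0 by omega, show ((0:ℕ) - (a2:ℤ)).natAbs = a2 by omega,
      show ((a0:ℤ)-a2).natAbs = a2 - a0 by omega]
  · rw [show ((a0:ℤ) - (0:ℕ)).natAbs = a0 by omega, show ((0:ℕ) - (a2:ℤ)).natAbs = a2 by omega,
      show ((a0:ℤ)-a2).natAbs = a0 - a2 by omega]
    tauto
  · rw [show ((a0:ℤ) - (0:ℕ)).natAbs = a0 by omega, show ((a1:ℤ) - (0:ℕ)).natAbs = a1 by omega,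
      show ((a0:ℤ)-a1).natAbs = a1 - a0 by omega]
    tauto
  · rw [show ((a0:ℤ) - (0:ℕ)).natAbs = a0 by omega, show ((a1:ℤ) - (0:ℕ)).natAbs = a1 by omega,
      show ((a0:ℤ)-a1).natAbs = a0 - a1 by omega]
    tauto

theorem dis_iff (a0 a1 a2 b0 b1 b2 : ℕ) (ha : a0 = 0 ∨ a1 = 0 ∨ a2 = 0)
    (hb : b0 = 0 ∨ b1 = 0 ∨ b2 = 0) :
    dis (md (a0,a1,a2)) (mx (a0,a1,a2)) (md (b0,b1,b2)) (mx (b0,b1,b2)) ↔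
    ((a0 + b0 ≠ a1 + b1 ∧ a0 + b0 ≠ a2 + b2 ∧ a1 + b1 ≠ a2 + b2) ∧
     (a2 + b1 ≠ a0 + b2 ∧ a2 + b1 ≠ a1 + b0 ∧ a0 + b2 ≠ a1 + b0) ∧
     (a1 + b2 ≠ a2 + b0 ∧ a1 + b2 ≠ a0 + b1 ∧ a2 + b0 ≠ a0 + b1) ∧
     (a0 + b0 ≠ a2 + b1 ∧ a0 + b0 ≠ a1 + b2 ∧ a2 + b1 ≠ a1 + b2) ∧
     (a1 + b1 ≠ a0 + b2 ∧ a1 + b1 ≠ a2 + b0 ∧ a0 + b2 ≠ a2 + b0) ∧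
     (a2 + b2 ≠ a1 + b0 ∧ a2 + b2 ≠ a0 + b1 ∧ a1 + b0 ≠ a0 + b1)) := by
  obtain ⟨p, m, hpm, h1, h2, h3⟩ := cases3 a0 a1 a2 ha
  obtain ⟨u, n, hun, h4, h5, h6⟩ := cases3 b0 b1 b2 hb
  rw [h1, h2, h4, h5]
  clear h1 h2 h4 h5 ha hb
  have hA : ∀ x : ℕ, (x = ((a0:ℤ)-a1).natAbs ∨ x = ((a0:ℤ)-a2).natAbs ∨ x = ((a1:ℤ)-a2).natAbs) ↔
      (x = p ∨ x = m - p ∨ x = m) := absset hpm h3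
  have hB : ∀ x : ℕ, (x = ((b0:ℤ)-b1).natAbs ∨ x = ((b0:ℤ)-b2).natAbs ∨ x = ((b1:ℤ)-b2).natAbs) ↔
      (x = u ∨ x = n - u ∨ x = n) := absset hun h6
  have hL : ∀ a a' b b' : ℕ, (a + b ≠ a' + b' ∧ a + b' ≠ a' + b) ↔
      ((a:ℤ)-a').natAbs ≠ ((b:ℤ)-b').natAbs := fun a a' b b' => by omega
  have h1 : dis p m u n ↔ ∀ x, (x = p ∨ x = m - p ∨ x = m) → ¬ (x = u ∨ x = n - u ∨ x = n) := by
    clear hA hB h3 h6 hL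
    constructor
    · rintro ⟨d1, d2, d3, d4, d5, d6, d7, d8, d9⟩ x (h|h|h) (k|k|k)
      · exact d1 (by rw [← h, k])
      · exact d2 (by clear * - h k hun; omega)
      · exact d3 (by rw [← h, k])
      · exact d4 (by clear * - h k hpm; omega)
      · exact d5 (by clear * - h k hpm hun; omega)
      · exact d6 (by clear * - h k hpm; omega)
      · exact d7 (by rw [← h, k])
      · exact d8 (by clear * - h k hun; omega)
      · exact d9 (by rw [← h, k])
    · intro h
      have h1 := h p (by simp)
      have h2 := h (m-p) (by simp)
      have h3 := h m (by simp)
      clear h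
      push Not at h1 h2 h3
      obtain ⟨d1, d2, d3⟩ := h1
      obtain ⟨d4, d5, d6⟩ := h2
      obtain ⟨d7, d8, d9⟩ := h3
      refine ⟨d1, ?_, d3, ?_, ?_, ?_, d7, ?_, d9⟩
      · clear * - d2 hun; omega
      · clear * - d4 hpm; omega
      · clear * - d5 hpm hun; omega
      · clear * - d6 hpm; omega
      · clear * - d8 hun; omega
  rw [h1]
  simp only [← hA, ← hB]
  clear hA hB h1 h3 h6 hun hpm
  constructor
  · intro h
    have e1 := h _ (Or.inl rfl)
    have e2 := h _ (Or.inr (Or.inl rfl))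
    have e3 := h _ (Or.inr (Or.inr rfl))
    simp only [not_or, ← ne_eq, ← hL] at e1 e2 e3
    clear h hL
    obtain ⟨⟨c1, c2⟩, ⟨c3, c4⟩, c5, c6⟩ := e1
    obtain ⟨⟨f1, f2⟩, ⟨f3, f4⟩, f5, f6⟩ := e2
    obtain ⟨⟨g1, g2⟩, ⟨g3, g4⟩, g5, g6⟩ := e3
    refine ⟨⟨?_, ?_, ?_⟩, ⟨?_, ?_, ?_⟩, ⟨?_, ?_, ?_⟩, ⟨?_, ?_, ?_⟩, ⟨?_, ?_, ?_⟩, ?_, ?_, ?_⟩ <;>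
      first | assumption | (symm; assumption)
  · rintro ⟨⟨c1, c2, c3⟩, ⟨c4, c5, c6⟩, ⟨f1, f2, f3⟩, ⟨f4, f5, f6⟩, ⟨g1, g2, g3⟩, g4, g5, g6⟩
    rintro x (rfl|rfl|rfl) <;> simp only [not_or, ← ne_eq, ← hL] <;>
    refine ⟨⟨?_, ?_⟩, ⟨?_, ?_⟩, ?_, ?_⟩ <;>
      first | assumption | (symm; assumption)

theorem liftne {a b a' b' c : ℕ} (h : a + b ≠ a' + b') :
    (a + b + c + 1 : ℤ) ≠ a' + b' + c + 1 := by omega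
theorem dropne {a b a' b' c : ℕ} (h : (a + b + c + 1 : ℤ) ≠ a' + b' + c + 1) :
    a + b ≠ a' + b' := by omega

theorem exmin (x y z : ℤ) : ∃ (μ : ℤ) (a b c : ℕ), x = μ + a ∧ y = μ + b ∧ z = μ + c ∧
    (a = 0 ∨ b = 0 ∨ c = 0) := by
  refine ⟨min x (min y z), (x - min x (min y z)).toNat, (y - min x (min y z)).toNat,
    (z - min x (min y z)).toNat, ?_, ?_, ?_, ?_⟩ <;> omega

theorem exphi (x : Matrix (Fin 3) (Fin 3) ℤ) (h1 : (0 < x 0 0 ∧ 0 < x 0 1 ∧ 0 < x 0 2 ∧ 0 < x 1 0 ∧ 0 < x 1 1 ∧ 0 < x 1 2 ∧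
      0 < x 2 0 ∧ 0 < x 2 1 ∧ 0 < x 2 2)) (h3 : (x 1 0 + x 1 1 + x 1 2 = x 0 0 + x 0 1 + x 0 2 ∧
      x 2 0 + x 2 1 + x 2 2 = x 0 0 + x 0 1 + x 0 2 ∧
      x 0 0 + x 1 0 + x 2 0 = x 0 0 + x 0 1 + x 0 2 ∧
      x 0 1 + x 1 1 + x 2 1 = x 0 0 + x 0 1 + x 0 2 ∧
      x 0 2 + x 1 2 + x 2 2 = x 0 0 + x 0 1 + x 0 2)) :
    ∃ a0 a1 a2 b0 b1 b2 c : ℕ, (a0 = 0 ∨ a1 = 0 ∨ a2 = 0) ∧ (b0 = 0 ∨ b1 = 0 ∨ b2 = 0) ∧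
      x = phi ((a0,a1,a2),(b0,b1,b2),c) := by
  obtain ⟨μ, a0, a1, a2, p0, p1, p2, ha⟩ := exmin (x 0 0) (x 1 2) (x 2 1)
  obtain ⟨ν, b0, b1, b2, q0, q1, q2, hb⟩ := exmin (x 0 0) (x 2 2) (x 1 1)
  have hc : ∃ c : ℕ, μ + ν - x 0 0 = c + 1 := by
    refine ⟨(μ + ν - x 0 0 - 1).toNat, ?_⟩
    have : 0 < μ + ν - x 0 0 := by
      rcases ha with rfl|rfl|rfl <;> rcases hb with rfl|rfl|rfl <;> omega
    omega
  obtain ⟨c, hc⟩ := hc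
  refine ⟨a0, a1, a2, b0, b1, b2, c, ha, hb, ?_⟩
  clear ha hb h1
  ext i j
  fin_cases i <;> fin_cases j <;> simp [phi] <;> omega

theorem Lc_eq (t : ℕ) : Lc t = (DD t).card := by
  unfold Lc
  rw [← Set.ncard_coe_finset, ← Set.InjOn.ncard_image (f := phi) (s := (DD t : Set _))]
  · congr 1
    ext x
    rw [Set.mem_ofPred_eq, magi_iff]
    constructor
    · rintro ⟨h1, h2, h3, h4⟩
      obtain ⟨a0, a1, a2, b0, b1, b2, c, ha, hb, rfl⟩ := exphi x h1 h3
      refine ⟨((a0,a1,a2),(b0,b1,b2),c), ?_, rfl⟩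
      simp only [DD, TT, Finset.coe_filter, Finset.mem_product, Finset.mem_filter, Finset.mem_range,
        Set.mem_ofPred_eq]
      simp only [phi, Matrix.of_apply, Matrix.cons_val] at h2 h4
      rw [dis_iff _ _ _ _ _ _ ha hb]
      clear h1 h3
      refine ⟨?_, ?_, ?_⟩
      · clear h4
        refine ⟨⟨⟨?_, ?_, ?_⟩, ha⟩, ⟨⟨?_, ?_, ?_⟩, hb⟩, ?_⟩ <;> omega
      · clear h2
        obtain ⟨⟨c1, c2, c3⟩, ⟨c4, c5, c6⟩, ⟨f1, f2, f3⟩, ⟨f4, f5, f6⟩, ⟨g1, g2, g3⟩, g4, g5, g6⟩ := h4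
        exact ⟨⟨dropne c1, dropne c2, dropne c3⟩, ⟨dropne c4, dropne c5, dropne c6⟩,
          ⟨dropne f1, dropne f2, dropne f3⟩, ⟨dropne f4, dropne f5, dropne f6⟩,
          ⟨dropne g1, dropne g2, dropne g3⟩, dropne g4, dropne g5, dropne g6⟩
      · clear h4
        simp only [mx]
        have : max a0 (max a1 a2) + max b0 (max b1 b2) + c + 1 < t := by
          have e1 : max a0 (max a1 a2) = a0 ∨ max a0 (max a1 a2) = a1 ∨ max a0 (max a1 a2) = a2 := by omega
          have e2 : max b0 (max b1 b2) = b0 ∨ max b0 (max b1 b2) = b1 ∨ max b0 (max b1 b2) = b2 := by omega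
          clear ha hb
          rcases e1 with e1|e1|e1 <;> rcases e2 with e2|e2|e2 <;> rw [e1, e2] <;> omega
        omega
    · rintro ⟨⟨⟨a0, a1, a2⟩, ⟨b0, b1, b2⟩, c⟩, hz, rfl⟩
      simp only [DD, TT, Finset.coe_filter, Finset.mem_product, Finset.mem_filter, Finset.mem_range,
        Set.mem_ofPred_eq] at hz
      obtain ⟨⟨⟨-, ha⟩, ⟨-, hb⟩, -⟩, hd, hc⟩ := hz
      rw [dis_iff _ _ _ _ _ _ ha hb] at hd
      simp only [phi, Matrix.of_apply, Matrix.cons_val]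
      have hm : max a0 (max a1 a2) + max b0 (max b1 b2) + c + 1 < t := by
        simp only [mx] at hc
        clear hd; omega
      clear hc ha hb
      refine ⟨?_, ?_, ?_, ?_⟩
      · clear hd; refine ⟨?_, ?_, ?_, ?_, ?_, ?_, ?_, ?_, ?_⟩ <;> omega
      · clear hd; refine ⟨?_, ?_, ?_, ?_, ?_, ?_, ?_, ?_, ?_⟩ <;> omega
      · clear hd; refine ⟨?_, ?_, ?_, ?_, ?_⟩ <;> omega
      · obtain ⟨⟨c1, c2, c3⟩, ⟨c4, c5, c6⟩, ⟨f1, f2, f3⟩, ⟨f4, f5, f6⟩, ⟨g1, g2, g3⟩, g4, g5, g6⟩ := hd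
        exact ⟨⟨liftne c1, liftne c2, liftne c3⟩, ⟨liftne c4, liftne c5, liftne c6⟩,
          ⟨liftne f1, liftne f2, liftne f3⟩, ⟨liftne f4, liftne f5, liftne f6⟩,
          ⟨liftne g1, liftne g2, liftne g3⟩, liftne g4, liftne g5, liftne g6⟩
  · rintro ⟨⟨a0, a1, a2⟩, ⟨b0, b1, b2⟩, c⟩ hz ⟨⟨a0', a1', a2'⟩, ⟨b0', b1', b2'⟩, c'⟩ hz' he
    simp only [DD, TT, Finset.coe_filter, Finset.mem_product, Finset.mem_filter, Finset.mem_range,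
        Set.mem_ofPred_eq] at hz hz'
    obtain ⟨⟨⟨-, ha⟩, ⟨-, hb⟩, -⟩, -⟩ := hz
    obtain ⟨⟨⟨-, ha'⟩, ⟨-, hb'⟩, -⟩, -⟩ := hz'
    have e := fun i j => congrFun (congrFun he i) j
    have e00 := e 0 0
    have e01 := e 0 1
    have e02 := e 0 2
    have e10 := e 1 0
    have e11 := e 1 1
    have e12 := e 1 2
    have e20 := e 2 0
    have e21 := e 2 1
    have e22 := e 2 2
    simp only [phi, Matrix.of_apply, Matrix.cons_val] at e00 e01 e02 e10 e11 e12 e20 e21 e22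
    simp only [Prod.mk.injEq]
    omega

def F12 (N : ℕ) : ℤ :=
  12 * ((N:ℤ) - 1) + 12 * (3*(N:ℤ)*((N-1)/2 : ℕ)*(((N-1)/2 : ℕ)+1)
    - ((N-1)/2 : ℕ)*(((N-1)/2 : ℕ)+1)*(2*((N-1)/2 : ℕ)+1)
    - 18*((N-1)/2 : ℕ)*(((N-1)/2 : ℕ)+1) + 18*((N-1)/2 : ℕ))
  + 72 * ((if N % 3 = 0 then ((N/3 : ℕ):ℤ) else 0) + 2*(((N-1)/2/2 : ℕ):ℤ)
    + 4*((((N-1)/2 : ℕ):ℤ) - ((N/3 : ℕ):ℤ))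
    + 2*(((((N-1)/2 + N%2)/2 : ℕ):ℤ) - (((N/3+N%2)/2 : ℕ):ℤ)))

def F5 (N : ℕ) : ℤ := if N % 5 = 0 then -144 else 0

theorem F12_gen (k r M a b c d : ℕ) (h1 : (12*(k+1)+r-1)/2 = 6*k+M) (h2 : (12*(k+1)+r)/3 = 4*k+a)
    (h3 : (6*k+M)/2 = 3*k+b) (h4 : (6*k+M + (12*(k+1)+r)%2)/2 = 3*k+c)
    (h5 : (4*k+a + (12*(k+1)+r)%2)/2 = 2*k+d) : F12 (12*(k+1)+r) =
      12 * ((12*((k:ℤ)+1)+r) - 1) + 12 * (3*(12*((k:ℤ)+1)+r)*(6*k+M)*(6*k+M+1)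
        - (6*k+M)*(6*k+M+1)*(2*(6*k+M)+1) - 18*(6*k+M)*(6*k+M+1) + 18*(6*k+M))
      + 72 * ((if r % 3 = 0 then (4*k+a:ℤ) else 0) + 2*(3*k+b:ℤ) + 4*((6*k+M:ℤ)-(4*k+a))
      + 2*((3*k+c:ℤ)-(2*k+d))) := by
  have : (12*(k+1)+r) % 3 = r % 3 := by omega
  unfold F12
  rw [h1, h2, h3, h4, h5, this]
  push_cast
  rfl

theorem F12_v0 (k : ℕ) : F12 (12*(k+1)+0) = 10368*((k:ℤ)+1)^3 + (-9072*((k:ℤ)+1)^2 + 4104*((k:ℤ)+1) - 804) := by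
  rw [F12_gen k 0 5 4 2 2 2 (by omega) (by omega) (by omega) (by omega) (by omega)]
  norm_num
  ring

theorem F12_v1 (k : ℕ) : F12 (12*(k+1)+1) = 10368*((k:ℤ)+1)^3 + (-5184*((k:ℤ)+1)^2 + 1440*((k:ℤ)+1)) := by
  rw [F12_gen k 1 6 4 3 3 2 (by omega) (by omega) (by omega) (by omega) (by omega)]
  norm_num
  ring

theorem F12_v2 (k : ℕ) : F12 (12*(k+1)+2) = 10368*((k:ℤ)+1)^3 + (-3888*((k:ℤ)+1)^2 + 1656*((k:ℤ)+1) + 12) := by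
  rw [F12_gen k 2 6 4 3 3 2 (by omega) (by omega) (by omega) (by omega) (by omega)]
  norm_num
  ring

theorem F12_v3 (k : ℕ) : F12 (12*(k+1)+3) = 10368*((k:ℤ)+1)^3 + (864*((k:ℤ)+1) + 24) := by
  rw [F12_gen k 3 7 5 3 4 3 (by omega) (by omega) (by omega) (by omega) (by omega)]
  norm_num
  ring

theorem F12_v4 (k : ℕ) : F12 (12*(k+1)+4) = 10368*((k:ℤ)+1)^3 + (1296*((k:ℤ)+1)^2 + 1224*((k:ℤ)+1) + 36) := by
  rw [F12_gen k 4 7 5 3 3 2 (by omega) (by omega) (by omega) (by omega) (by omega)]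
  norm_num
  ring

theorem F12_v5 (k : ℕ) : F12 (12*(k+1)+5) = 10368*((k:ℤ)+1)^3 + (5184*((k:ℤ)+1)^2 + 1440*((k:ℤ)+1) + 336) := by
  rw [F12_gen k 5 8 5 4 4 3 (by omega) (by omega) (by omega) (by omega) (by omega)]
  norm_num
  ring

theorem F12_v6 (k : ℕ) : F12 (12*(k+1)+6) = 10368*((k:ℤ)+1)^3 + (6480*((k:ℤ)+1)^2 + 2808*((k:ℤ)+1) + 420) := by
  rw [F12_gen k 6 8 6 4 4 3 (by omega) (by omega) (by omega) (by omega) (by omega)]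
  norm_num
  ring

theorem F12_v7 (k : ℕ) : F12 (12*(k+1)+7) = 10368*((k:ℤ)+1)^3 + (10368*((k:ℤ)+1)^2 + 4032*((k:ℤ)+1) + 720) := by
  rw [F12_gen k 7 9 6 4 5 3 (by omega) (by omega) (by omega) (by omega) (by omega)]
  norm_num
  ring

theorem F12_v8 (k : ℕ) : F12 (12*(k+1)+8) = 10368*((k:ℤ)+1)^3 + (11664*((k:ℤ)+1)^2 + 5544*((k:ℤ)+1) + 1020) := by
  rw [F12_gen k 8 9 6 4 4 3 (by omega) (by omega) (by omega) (by omega) (by omega)]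
  norm_num
  ring

theorem F12_v9 (k : ℕ) : F12 (12*(k+1)+9) = 10368*((k:ℤ)+1)^3 + (15552*((k:ℤ)+1)^2 + 8640*((k:ℤ)+1) + 1752) := by
  rw [F12_gen k 9 10 7 5 5 4 (by omega) (by omega) (by omega) (by omega) (by omega)]
  norm_num
  ring

theorem F12_v10 (k : ℕ) : F12 (12*(k+1)+10) = 10368*((k:ℤ)+1)^3 + (16848*((k:ℤ)+1)^2 + 10296*((k:ℤ)+1) + 2412) := by
  rw [F12_gen k 10 10 7 5 5 3 (by omega) (by omega) (by omega) (by omega) (by omega)]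
  norm_num
  ring

theorem F12_v11 (k : ℕ) : F12 (12*(k+1)+11) = 10368*((k:ℤ)+1)^3 + (20736*((k:ℤ)+1)^2 + 14400*((k:ℤ)+1) + 3648) := by
  rw [F12_gen k 11 11 7 5 6 4 (by omega) (by omega) (by omega) (by omega) (by omega)]
  norm_num
  ring

theorem sum12 (k : ℕ) :
    (∑ N ∈ Finset.range (12*(k+1)), F12 N = 31104*((k:ℤ)+1)^4 - 38880*((k:ℤ)+1)^3
      + 24336*((k:ℤ)+1)^2 - 6984*((k:ℤ)+1) + 792) ∧
    (5 * ∑ N ∈ Finset.range (12*(k+1)), (N:ℤ) * F12 N = 1492992*((k:ℤ)+1)^5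
      - 1827360*((k:ℤ)+1)^4 + 1072800*((k:ℤ)+1)^3 - 279720*((k:ℤ)+1)^2 + 29568*((k:ℤ)+1)) := by
  induction k with
  | zero => constructor <;> simp [Finset.sum_range_succ, F12]
  | succ k ih =>
    obtain ⟨h1, h2⟩ := ih
    have e : 12*(k+1+1) = 12*(k+1) + 12 := by ring
    rw [e, Finset.sum_range_add, Finset.sum_range_add, h1, mul_add (5:ℤ) (∑ N ∈ _, _), h2]
    have v0 := F12_v0 k
    simp only [add_zero] at v0
    constructor
    · simp only [Finset.sum_range_succ, Finset.sum_range_zero, add_zero, zero_add,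
        v0, F12_v1 k, F12_v2 k, F12_v3 k, F12_v4 k, F12_v5 k, F12_v6 k, F12_v7 k, F12_v8 k, F12_v9 k, F12_v10 k, F12_v11 k]
      push_cast; ring
    · simp only [Finset.sum_range_succ, Finset.sum_range_zero, add_zero, zero_add,
        v0, F12_v1 k, F12_v2 k, F12_v3 k, F12_v4 k, F12_v5 k, F12_v6 k, F12_v7 k, F12_v8 k, F12_v9 k, F12_v10 k, F12_v11 k]
      push_cast; ring

theorem sum5 (k : ℕ) :
    (∑ N ∈ Finset.range (5*k), F5 N = -144*k) ∧
    (∑ N ∈ Finset.range (5*k), (N:ℤ) * F5 N = -360*(k:ℤ)^2 + 360*k) := by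
  induction k with
  | zero => simp
  | succ k ih =>
    obtain ⟨h1, h2⟩ := ih
    have e : 5*(k+1) = 5*k+5 := by ring
    rw [e, Finset.sum_range_add, Finset.sum_range_add, h1, h2]
    constructor
    · simp [Finset.sum_range_succ, F5, Nat.add_mod]; ring
    · simp [Finset.sum_range_succ, F5, Nat.add_mod]; ring

theorem sum_final (k : ℕ) :
    120 * ∑ N ∈ Finset.range (60*(k+1)), (F12 N + F5 N) * (60*((k:ℤ)+1) - 1 - N) =
      36*(60*((k:ℤ)+1))^5 - 765*(60*((k:ℤ)+1))^4 + 8080*(60*((k:ℤ)+1))^3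
        - 45228*(60*((k:ℤ)+1))^2 + 119280*(60*((k:ℤ)+1)) - 113760
      + 120 * (F12 0 + F5 0) * (60*((k:ℤ)+1) - 1) := by
  have h : ∑ N ∈ Finset.range (60*(k+1)), (F12 N + F5 N) * (60*((k:ℤ)+1) - 1 - N)
      = (60*((k:ℤ)+1) - 1) * (∑ N ∈ Finset.range (60*(k+1)), F12 N
        + ∑ N ∈ Finset.range (60*(k+1)), F5 N)
       - (∑ N ∈ Finset.range (60*(k+1)), (N:ℤ) * F12 N
        + ∑ N ∈ Finset.range (60*(k+1)), (N:ℤ) * F5 N) := by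
    rw [← Finset.sum_add_distrib, ← Finset.sum_add_distrib, Finset.mul_sum,
      ← Finset.sum_sub_distrib]
    exact Finset.sum_congr rfl fun _ _ => by ring
  obtain ⟨a, b⟩ := sum12 (5*k+4)
  obtain ⟨c, d⟩ := sum5 (12*(k+1))
  rw [show 12*(5*k+4+1) = 60*(k+1) by ring] at a b
  rw [show 5*(12*(k+1)) = 60*(k+1) by ring] at c d
  rw [h, a, c, d]
  have h0 : F12 0 + F5 0 = -156 := by simp [F12, F5]
  rw [mul_assoc, h0]
  push_cast at b ⊢
  linear_combination -24*b

def w (p m : ℕ) : ℤ := if 0 < p ∧ p < m then 6 else if m = 0 then 1 else 3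

theorem ind_sum_s16 (k c : ℕ) (P : ℕ → Prop) [DecidablePred P] (Q : Prop) [Decidable Q] (f : ℕ → ℤ)
    (h1 : ∀ p < k, P p ↔ (Q ∧ p = c)) (h2 : Q → c < k) :
    ∑ p ∈ Finset.range k, (if P p then f p else 0) = if Q then f c else 0 := by
  rw [Finset.sum_congr rfl (g := fun p => if Q ∧ p = c then f p else 0)
    (fun p hp => if_congr (h1 p (Finset.mem_range.1 hp)) rfl rfl)]
  by_cases hQ : Q
  · simp only [hQ, true_and, if_true]
    rw [Finset.sum_ite_eq' (Finset.range k) c f, if_pos (Finset.mem_range.2 (h2 hQ))]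
  · simp [hQ]

theorem sum_w (n : ℕ) (hn : 0 < n) : ∑ u ∈ Finset.range (n+1), w u n = 6 * n := by
  obtain ⟨k, rfl⟩ : ∃ k, n = k + 1 := ⟨n-1, by omega⟩
  rw [Finset.sum_range_succ, Finset.sum_range_succ']
  rw [Finset.sum_congr rfl (g := fun _ => (6:ℤ))
    (fun p hp => by have := Finset.mem_range.1 hp; unfold w; rw [if_pos (by omega)])]
  simp [w]; ring

theorem sum_mem_ind (k : ℕ) (E : Finset ℕ) (hE : ∀ x ∈ E, x < k) :
    ∑ u ∈ Finset.range k, (if u ∈ E then (1:ℤ) else 0) = E.card := by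
  rw [Finset.sum_ite_mem, Finset.inter_eq_right.2 (fun x hx => Finset.mem_range.2 (hE x hx))]
  simp

def U (p m n : ℕ) : ℤ := ∑ u ∈ Finset.range (n+1), (w u n * if dis p m u n then 1 else 0)

theorem U_zero (n : ℕ) (hn : 0 < n) : U 0 0 n = 6 * ((n:ℤ) - 1) := by
  unfold U
  have : ∀ u ∈ Finset.range (n+1), (w u n * if dis 0 0 u n then 1 else 0)
      = w u n - 3 * (if u ∈ ({0, n} : Finset ℕ) then 1 else 0) := by
    intro u hu
    have := Finset.mem_range.1 hu
    simp only [Finset.mem_insert, Finset.mem_singleton]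
    by_cases h : u = 0 ∨ u = n
    · have hd : ¬ dis 0 0 u n := by unfold dis; omega
      have hw : w u n = 3 := by unfold w; rw [if_neg (by omega), if_neg (by omega)]
      rw [if_neg hd, hw, if_pos h]; simp
    · have hd : dis 0 0 u n := by unfold dis; omega
      rw [if_pos hd, if_neg h]; simp
  rw [Finset.sum_congr rfl this, Finset.sum_sub_distrib, sum_w n hn, ← Finset.mul_sum,
    sum_mem_ind, Finset.card_pair (by omega)]
  · push_cast; ring
  · simp

theorem U_edge (p m n : ℕ) (hm : 0 < m) (hn : m < n) (hp : p = 0 ∨ p = m) :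
    U p m n = 6 * ((n:ℤ) - 3 + if n = 2*m then 1 else 0) := by
  unfold U
  have : ∀ u ∈ Finset.range (n+1), (w u n * if dis p m u n then 1 else 0)
      = w u n - 3 * (if u ∈ ({0, n} : Finset ℕ) then 1 else 0)
        - 6 * (if u ∈ ({m, n-m} : Finset ℕ) then 1 else 0) := by
    intro u hu
    have := Finset.mem_range.1 hu
    simp only [Finset.mem_insert, Finset.mem_singleton]
    by_cases h : u = 0 ∨ u = n
    · have hd : ¬ dis p m u n := by unfold dis; omega
      have hw : w u n = 3 := by unfold w; rw [if_neg (by omega), if_neg (by omega)]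
      rw [if_neg hd, hw, if_pos h, if_neg (by omega)]; simp
    · by_cases hh : u = m ∨ u = n - m
      · have hd : ¬ dis p m u n := by unfold dis; omega
        have hw : w u n = 6 := by unfold w; rw [if_pos (by omega)]
        rw [if_neg hd, hw, if_neg h, if_pos hh]; simp
      · have hd : dis p m u n := by unfold dis; rcases hp with rfl | rfl <;> omega
        rw [if_pos hd, if_neg h, if_neg hh]; simp
  rw [Finset.sum_congr rfl this, Finset.sum_sub_distrib, Finset.sum_sub_distrib, sum_w n (by omega),
    ← Finset.mul_sum, ← Finset.mul_sum,
    sum_mem_ind, sum_mem_ind, Finset.card_pair (by omega)]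
  · by_cases h : n = 2 * m
    · rw [if_pos h, show n - m = m by omega]; simp; ring
    · rw [if_neg h, Finset.card_pair (by omega)]; push_cast; ring
  · simp only [Finset.mem_insert, Finset.mem_singleton]; omega
  · simp only [Finset.mem_insert, Finset.mem_singleton]; omega

theorem card_E_s16 (p m n : ℕ) (hp : 0 < p) (hpm : p < m) (hn : m < n) :
    ((({p, m-p, m, n-p, n-m+p, n-m} : Finset ℕ).card : ℕ) : ℤ) =
    6 - (2 * (if 2*p = m then 1 else 0) + (if 2*p = n then 1 else 0) + (if 2*(m-p) = n then 1 else 0)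
      + (if 2*m = n then 1 else 0) + 2 * (if p + m = n then 1 else 0)
      + 2 * (if 2*m = n + p then 1 else 0) - 2 * (if 2*p = m ∧ 3*p = n then 1 else 0)) := by
  simp only [Finset.card_insert_eq_ite, Finset.mem_insert, Finset.mem_singleton,
    Finset.card_singleton]
  have c1 : (p = m-p ∨ p = m ∨ p = n-p ∨ p = n-m+p ∨ p = n-m) ↔ (2*p = m ∨ 2*p = n ∨ p+m = n) := by
    omega
  have c2 : (m-p = m ∨ m-p = n-p ∨ m-p = n-m+p ∨ m-p = n-m) ↔ (2*(m-p) = n ∨ 2*m = n+p) := by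
    omega
  have c3 : (m = n-p ∨ m = n-m+p ∨ m = n-m) ↔ (p+m = n ∨ 2*m = n+p ∨ 2*m = n) := by
    omega
  have c4 : (n-p = n-m+p ∨ n-p = n-m) ↔ 2*p = m := by omega
  have c5 : ¬ (n-m+p = n-m) := by omega
  simp only [c1, c2, c3, c4, c5, if_false]
  clear c1 c2 c3 c4 c5
  by_cases hA : 2*p = m
  · have hB : ¬ (2*p = n) := by omega
    have hC : ¬ (2*(m-p) = n) := by omega
    have hF : (2*m = n+p) ↔ p+m = n := by omega
    have hG : (3*p = n) ↔ p+m = n := by omega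
    simp only [hA, hB, hC, hF, hG, true_and, true_or, false_or, if_true, if_false]
    have hB' : ¬ (m = n) := by omega
    by_cases hE : p + m = n
    · have hD : ¬ (2*m = n) := by omega
      simp [hE, hD, hB']
    · by_cases hD : 2*m = n <;> simp [hE, hD, hB']
  · have hp0 : p ≠ 0 := by omega
    simp only [hA, false_and, false_or, if_false]
    by_cases hD : 2*m = n
    · have hB : ¬ (2*p = n) := by omega
      have hC : ¬ (2*(m-p) = n) := by omega
      have hE : ¬ (p+m = n) := by omega
      have hF : ¬ (2*m = n+p) := by omega
      simp only [hB, hC, hE, hF, hD, or_false, or_true, if_true, if_false]; norm_num [hp0]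
    · by_cases hE : p + m = n
      · have hB : ¬ (2*p = n) := by omega
        have hF : ¬ (2*m = n+p) := by omega
        by_cases hC : 2*(m-p) = n <;>
        simp only [hB, hC, hE, hF, hD, or_false, or_true, true_or, if_true, if_false] <;> norm_num [hp0]
      · by_cases hF : 2*m = n+p
        · have hC : ¬ (2*(m-p) = n) := by omega
          by_cases hB : 2*p = n
          · simp only [hB, hC, hE, hF, hD, or_false, or_true, true_or, if_true, if_false]; norm_num [hp0]
          · simp only [hB, hC, hE, hF, hD, or_false, or_true, true_or, if_true, if_false]; norm_num [hp0]
        · by_cases hC : 2*(m-p) = n <;> by_cases hB : 2*p = n <;>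
          simp only [hB, hC, hE, hF, hD, or_false, or_true, true_or, if_true, if_false] <;> norm_num [hp0]

theorem U_int (p m n : ℕ) (hp : 0 < p) (hpm : p < m) (hn : m < n) :
    U p m n = 6 * ((n:ℤ) - 6 + (2 * (if 2*p = m then 1 else 0) + (if 2*p = n then 1 else 0)
      + (if 2*(m-p) = n then 1 else 0)
      + (if 2*m = n then 1 else 0) + 2 * (if p + m = n then 1 else 0)
      + 2 * (if 2*m = n + p then 1 else 0) - 2 * (if 2*p = m ∧ 3*p = n then 1 else 0))) := by
  unfold U
  have : ∀ u ∈ Finset.range (n+1), (w u n * if dis p m u n then 1 else 0)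
      = w u n - 6 * (if u ∈ ({p, m-p, m, n-p, n-m+p, n-m} : Finset ℕ) then 1 else 0) := by
    intro u hu
    have := Finset.mem_range.1 hu
    simp only [Finset.mem_insert, Finset.mem_singleton]
    by_cases h : u = p ∨ u = m-p ∨ u = m ∨ u = n-p ∨ u = n-m+p ∨ u = n-m
    · rw [if_pos h, if_neg]
      · unfold w
        rw [if_pos]
        · simp
        · rcases h with h|h|h|h|h|h <;> omega
      · unfold dis
        rcases h with h|h|h|h|h|h <;> omega
    · rw [if_neg h, if_pos]
      · simp
      · push Not at h
        obtain ⟨h1, h2, h3, h4, h5, h6⟩ := h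
        unfold dis
        refine ⟨Ne.symm h1, ?_, ?_, ?_, ?_, ?_, Ne.symm h3, ?_, ?_⟩
        · clear * - h4; omega
        · omega
        · clear * - h2; omega
        · clear * - h5 hn; omega
        · omega
        · clear * - h6; omega
        · omega
  rw [Finset.sum_congr rfl this, Finset.sum_sub_distrib, sum_w n (by omega),
    ← Finset.mul_sum, sum_mem_ind, card_E_s16 p m n hp hpm hn]
  · ring
  · simp only [Finset.mem_insert, Finset.mem_singleton]; omega

def V (m n : ℕ) : ℤ := ∑ p ∈ Finset.range (m+1), w p m * U p m n

theorem V_zero (n : ℕ) (hn : 0 < n) : V 0 n = 6 * ((n:ℤ) - 1) := by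
  simp [V, U_zero n hn, w]

theorem V_pos (m n : ℕ) (hm : 0 < m) (hn : m < n) : V m n = 36 * ((m:ℤ)*n - 6*m + 3
    + (if n = 2*m then (m:ℤ) else 0) + 2 * (if m % 2 = 0 then 1 else 0)
    + 2 * (if n % 2 = 0 ∧ n < 2*m then 1 else 0) + 4 * (if n < 2*m then 1 else 0)
    - 2 * (if 2*n = 3*m then 1 else 0)) := by
  unfold V
  obtain ⟨k, rfl⟩ : ∃ k, m = k + 1 := ⟨m-1, by omega⟩
  rw [Finset.sum_range_succ, Finset.sum_range_succ', U_edge 0 _ n hm hn (Or.inl rfl),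
    U_edge (k+1) _ n hm hn (Or.inr rfl)]
  rw [Finset.sum_congr rfl (fun p hp => by
    have := Finset.mem_range.1 hp
    rw [U_int (p+1) (k+1) n (by omega) (by omega) hn, w, if_pos (by omega)])]
  rw [← Finset.mul_sum, ← Finset.mul_sum, Finset.sum_add_distrib, Finset.sum_sub_distrib, Finset.sum_sub_distrib,
    Finset.sum_add_distrib, Finset.sum_add_distrib, Finset.sum_add_distrib, Finset.sum_add_distrib,
    Finset.sum_add_distrib, ← Finset.mul_sum, ← Finset.mul_sum, ← Finset.mul_sum, ← Finset.mul_sum]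
  rw [ind_sum_s16 k ((k+1)/2-1) (fun p => 2*(p+1) = k+1) ((k+1)%2 = 0) (fun _ => 1)
    (fun p hp => by omega) (by omega)]
  rw [ind_sum_s16 k (n/2-1) (fun p => 2*(p+1) = n) (n%2 = 0 ∧ n < 2*(k+1)) (fun _ => 1)
    (fun p hp => by omega) (by omega)]
  rw [ind_sum_s16 k (k+1-n/2-1) (fun p => 2*(k+1-(p+1)) = n) (n%2 = 0 ∧ n < 2*(k+1)) (fun _ => 1)
    (fun p hp => by omega) (by omega)]
  rw [ind_sum_s16 k (n-(k+1)-1) (fun p => p+1+(k+1) = n) (n < 2*(k+1)) (fun _ => 1)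
    (fun p hp => by omega) (by omega)]
  rw [ind_sum_s16 k (2*(k+1)-n-1) (fun p => 2*(k+1) = n+(p+1)) (n < 2*(k+1)) (fun _ => 1)
    (fun p hp => by omega) (by omega)]
  rw [ind_sum_s16 k ((k+1)/2-1) (fun p => 2*(p+1) = k+1 ∧ 3*(p+1) = n) (2*n = 3*(k+1)) (fun _ => 1)
    (fun p hp => by omega) (by omega)]
  simp only [Finset.sum_const, Finset.card_range, nsmul_eq_mul, eq_comm (a := 2*(k+1)) (b := n)]
  have w1 : w 0 (k+1) = 3 := by simp [w]
  have w2 : w (k+1) (k+1) = 3 := by simp [w]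
  rw [w1, w2]
  by_cases hh : n = 2*(k+1)
  · simp only [hh, if_true]; push_cast; ring
  · simp only [hh, if_false]; push_cast; ring

theorem s1 (N : ℤ) (M : ℕ) : 6 * ∑ i ∈ Finset.range M, (((i:ℤ)+1)*(N-(i+1)) - 6*(i+1) + 3) =
    3*N*M*(M+1) - M*(M+1)*(2*M+1) - 18*M*(M+1) + 18*M := by
  induction M with
  | zero => simp
  | succ M ih => rw [Finset.sum_range_succ, mul_add, ih]; push_cast; ring

theorem s2 (M : ℕ) : ∑ i ∈ Finset.range M, (if (i+1)%2 = 0 then (1:ℤ) else 0) = (M/2 : ℕ) := by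
  induction M with
  | zero => simp
  | succ M ih => rw [Finset.sum_range_succ, ih]; split_ifs <;> omega

theorem s3 (N M : ℕ) : ∑ i ∈ Finset.range M, (if N < 3*(i+1) then (1:ℤ) else 0)
    = (M - N/3 : ℕ) := by
  induction M with
  | zero => simp
  | succ M ih => rw [Finset.sum_range_succ, ih]; split_ifs <;> omega

theorem s4 (N M : ℕ) : ∑ i ∈ Finset.range M, (if (i+1)%2 = N%2 ∧ N < 3*(i+1) then (1:ℤ) else 0)
    = ((M + N%2)/2 - (N/3 + N%2)/2 : ℕ) := by
  induction M with
  | zero => simp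
  | succ M ih => rw [Finset.sum_range_succ, ih]; split_ifs <;> omega

theorem F_eq (N : ℕ) (hN : 0 < N) :
    2 * ∑ m ∈ Finset.range ((N+1)/2), V m (N-m) = F12 N + F5 N := by
  obtain ⟨M, hM⟩ : ∃ M, M = (N-1)/2 := ⟨_, rfl⟩
  rw [show (N+1)/2 = M+1 by omega, Finset.sum_range_succ', Nat.sub_zero, V_zero N hN]
  have hv : ∀ i ∈ Finset.range M, V (i+1) (N-(i+1)) = 36 * (((i:ℤ)+1)*(N-(i+1)) - 6*(i+1) + 3
    + (if N = 3*(i+1) then ((i:ℤ)+1) else 0) + 2 * (if (i+1) % 2 = 0 then 1 else 0)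
    + 2 * (if (i+1)%2 = N%2 ∧ N < 3*(i+1) then 1 else 0) + 4 * (if N < 3*(i+1) then 1 else 0)
    - 2 * (if 2*N = 5*(i+1) then 1 else 0)) := by
      intro p hp
      have := Finset.mem_range.1 hp
      rw [V_pos (p+1) (N-(p+1)) (by omega) (by omega), Nat.cast_sub (by omega)]
      push_cast
      simp only [show N - (p+1) = 2*(p+1) ↔ N = 3*(p+1) by omega,
        show (N - (p+1))%2 = 0 ↔ (p+1)%2 = N%2 by omega,
        show N - (p+1) < 2*(p+1) ↔ N < 3*(p+1) by omega,
        show 2*(N - (p+1)) = 3*(p+1) ↔ 2*N = 5*(p+1) by omega]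
  rw [Finset.sum_congr rfl hv]
  rw [← Finset.mul_sum, Finset.sum_sub_distrib, Finset.sum_add_distrib, Finset.sum_add_distrib,
    Finset.sum_add_distrib, Finset.sum_add_distrib, ← Finset.mul_sum, ← Finset.mul_sum,
    ← Finset.mul_sum, ← Finset.mul_sum, s2, s3, s4]
  rw [ind_sum_s16 M (N/3-1) (fun i => N = 3*(i+1)) (N%3=0) (fun i => (i:ℤ)+1)
    (fun p hp => by omega) (by omega)]
  rw [ind_sum_s16 M (2*(N/5)-1) (fun i => 2*N = 5*(i+1)) (N%5=0) (fun i => 1)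
    (fun p hp => by omega) (by omega)]
  have h1 := s1 N M
  unfold F12 F5
  rw [← hM, show ((M - N/3 : ℕ):ℤ) = (M:ℤ) - (N/3 : ℕ) from Nat.cast_sub (by omega),
    show (((M + N%2)/2 - (N/3 + N%2)/2 : ℕ):ℤ) = ((M + N%2)/2 : ℕ) - ((N/3 + N%2)/2 : ℕ) from
      Nat.cast_sub (by omega)]
  have h3 : (if N%3 = 0 then (((N/3-1 : ℕ):ℤ)+1) else 0) = if N%3 = 0 then ((N/3 : ℕ):ℤ) else 0 := by
    split_ifs <;> omega
  have h5 : (if N%5 = 0 then (-144:ℤ) else 0) = -144 * (if N%5=0 then 1 else 0) := by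
    split_ifs <;> simp
  rw [h3, h5]
  linear_combination 12 * h1

theorem card_DD (t : ℕ) : ((DD t).card : ℤ) = ∑ a ∈ TT t, ∑ b ∈ TT t,
    (if dis (md a) (mx a) (md b) (mx b) then ((t - 1 - mx a - mx b : ℕ):ℤ) else 0) := by
  unfold DD
  rw [Finset.card_filter, Finset.sum_product]
  push_cast
  refine Finset.sum_congr rfl fun a _ => ?_
  rw [Finset.sum_product]
  refine Finset.sum_congr rfl fun b _ => ?_
  by_cases h : dis (md a) (mx a) (md b) (mx b)
  · simp only [h, true_and, if_true]
    have := sum_mem_ind t (Finset.range (t-1-mx a-mx b)) (by simp only [Finset.mem_range]; omega)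
    simpa using this
  · simp [h]

theorem fiber_card (t p m : ℕ) (hm : m < t) (hp : p ≤ m) :
    (((TT t).filter (fun a => (mx a, md a) = (m, p))).card : ℤ) = w p m := by
  have : (TT t).filter (fun a => (mx a, md a) = (m, p)) =
      {(0,p,m), (0,m,p), (p,0,m), (m,0,p), (p,m,0), (m,p,0)} := by
    ext ⟨a0, a1, a2⟩
    simp only [TT, Finset.mem_filter, Finset.mem_product, Finset.mem_range, Finset.mem_insert,
      Finset.mem_singleton, Prod.mk.injEq]
    constructor
    · rintro ⟨⟨-, h⟩, h1, h2⟩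
      obtain ⟨p', m', -, h3, h4, h5⟩ := cases3 a0 a1 a2 h
      rw [h1] at h4; rw [h2] at h3
      subst h3 h4
      exact h5
    · rintro (⟨rfl, rfl, rfl⟩ | ⟨rfl, rfl, rfl⟩ | ⟨rfl, rfl, rfl⟩ | ⟨rfl, rfl, rfl⟩ |
        ⟨rfl, rfl, rfl⟩ | ⟨rfl, rfl, rfl⟩) <;> simp only [md, mx] <;>
        refine ⟨⟨⟨?_, ?_, ?_⟩, ?_⟩, ?_, ?_⟩ <;> first | omega | simp
  rw [this]
  unfold w
  by_cases h : 0 < p ∧ p < m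
  · rw [if_pos h]
    rw [Finset.card_insert_of_notMem, Finset.card_insert_of_notMem, Finset.card_insert_of_notMem,
      Finset.card_insert_of_notMem, Finset.card_insert_of_notMem, Finset.card_singleton]
    · norm_num
    all_goals
      simp only [Finset.mem_insert, Finset.mem_singleton, Prod.mk.injEq]; omega
  · rw [if_neg h]
    by_cases h0 : m = 0
    · obtain rfl : p = 0 := by omega
      subst h0; simp
    · rw [if_neg h0]
      rcases (show p = 0 ∨ p = m by omega) with rfl | rfl
      · have e : ({(0,0,m), (0,m,0), (0,0,m), (m,0,0), (0,m,0), (m,0,0)} : Finset T3) =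
          {(0,0,m), (0,m,0), (m,0,0)} := by
          ext x; simp only [Finset.mem_insert, Finset.mem_singleton]; tauto
        rw [e, Finset.card_eq_three.2 ⟨_, _, _, ?_, ?_, ?_, rfl⟩]
        · norm_num
        all_goals simp only [ne_eq, Prod.mk.injEq]; omega
      · have e : ({(0,p,p), (0,p,p), (p,0,p), (p,0,p), (p,p,0), (p,p,0)} : Finset T3) =
          {(0,p,p), (p,0,p), (p,p,0)} := by
          ext x; simp only [Finset.mem_insert, Finset.mem_singleton]; tauto
        rw [e, Finset.card_eq_three.2 ⟨_, _, _, ?_, ?_, ?_, rfl⟩]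
        · norm_num
        all_goals simp only [ne_eq, Prod.mk.injEq]; omega

theorem fiber_sum (t : ℕ) (G : ℕ → ℕ → ℤ) : ∑ a ∈ TT t, G (md a) (mx a) =
    ∑ m ∈ Finset.range t, ∑ p ∈ Finset.range (m+1), w p m * G p m := by
  rw [Finset.sum_sigma']
  have hmap : ∀ a ∈ TT t, (⟨mx a, md a⟩ : (_ : ℕ) × ℕ) ∈
      (Finset.range t).sigma (fun m => Finset.range (m+1)) := by
    rintro ⟨a0, a1, a2⟩ ha
    simp only [TT, Finset.mem_filter, Finset.mem_product, Finset.mem_range] at ha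
    simp only [Finset.mem_sigma, Finset.mem_range, mx, md]
    omega
  rw [← Finset.sum_fiberwise_of_maps_to hmap]
  refine Finset.sum_congr rfl ?_
  rintro ⟨m, p⟩ hx
  simp only [Finset.mem_sigma, Finset.mem_range] at hx
  rw [← fiber_card t p m (by omega) (by omega), Finset.sum_congr rfl (g := fun _ => G p m),
    Finset.sum_const, nsmul_eq_mul]
  · simp
  · intro a ha
    have := (Finset.mem_filter.1 ha).2
    simp at this
    rw [this.1, this.2]

theorem sum_symm (t : ℕ) (g : ℕ → ℕ → ℤ) (h0 : ∀ m, g m m = 0) (hs : ∀ m n, g m n = g n m) :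
    ∑ m ∈ Finset.range t, ∑ n ∈ Finset.range t, g m n =
    2 * ∑ n ∈ Finset.range t, ∑ m ∈ Finset.range n, g m n := by
  induction t with
  | zero => simp
  | succ t ih =>
    rw [Finset.sum_range_succ, Finset.sum_range_succ, Finset.sum_range_succ, mul_add, ← ih, h0,
      Finset.sum_congr rfl (fun m _ => Finset.sum_range_succ _ _), Finset.sum_add_distrib,
      Finset.sum_congr rfl (fun n _ => hs t n)]
    ring

theorem dis_symm (p m u n : ℕ) : dis p m u n ↔ dis u n p m := by
  unfold dis
  constructor <;> rintro ⟨d1, d2, d3, d4, d5, d6, d7, d8, d9⟩ <;>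
    refine ⟨?_, ?_, ?_, ?_, ?_, ?_, ?_, ?_, ?_⟩ <;> intro h <;>
    first
    | exact d1 (by clear * - h; omega) | exact d2 (by clear * - h; omega)
    | exact d3 (by clear * - h; omega) | exact d4 (by clear * - h; omega)
    | exact d5 (by clear * - h; omega) | exact d6 (by clear * - h; omega)
    | exact d7 (by clear * - h; omega) | exact d8 (by clear * - h; omega)
    | exact d9 (by clear * - h; omega)

theorem V_symm (m n : ℕ) : V m n = V n m := by
  unfold V U
  simp only [Finset.mul_sum]
  rw [Finset.sum_comm]
  refine Finset.sum_congr rfl fun u _ => Finset.sum_congr rfl fun p _ => ?_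
  simp only [dis_symm p m u n]
  ring

theorem V_diag (m : ℕ) : V m m = 0 := by
  unfold V U
  simp [dis]

theorem Lc_sum (t : ℕ) : (Lc t : ℤ) = 2 * ∑ n ∈ Finset.range t, ∑ m ∈ Finset.range n,
    V m n * ((t - 1 - m - n : ℕ):ℤ) := by
  rw [Lc_eq, card_DD]
  rw [← sum_symm t (fun m n => V m n * ((t - 1 - m - n : ℕ):ℤ)) (fun m => by simp [V_diag])
    (fun m n => by rw [V_symm, Nat.sub_right_comm])]
  rw [Finset.sum_congr rfl (fun a _ => fiber_sum t (fun u n => if dis (md a) (mx a) u n then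
    ((t - 1 - mx a - n : ℕ):ℤ) else 0))]
  rw [fiber_sum t (fun p m => ∑ n ∈ Finset.range t, ∑ u ∈ Finset.range (n+1), w u n *
    (if dis p m u n then ((t - 1 - m - n : ℕ):ℤ) else 0))]
  refine Finset.sum_congr rfl fun m _ => ?_
  simp only [Finset.mul_sum]
  rw [Finset.sum_comm]
  refine Finset.sum_congr rfl fun n _ => ?_
  unfold V U
  rw [Finset.sum_mul]
  refine Finset.sum_congr rfl fun p _ => ?_
  rw [Finset.mul_sum, Finset.sum_mul]
  refine Finset.sum_congr rfl fun u _ => ?_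
  split_ifs <;> ring

theorem regroup (t : ℕ) (g : ℕ → ℕ → ℤ) :
    ∑ n ∈ Finset.range t, ∑ m ∈ Finset.range n, g m n * ((t - 1 - m - n : ℕ):ℤ) =
    ∑ N ∈ Finset.range t, (∑ m ∈ Finset.range ((N+1)/2), g m (N-m)) * ((t - 1 - N : ℕ):ℤ) := by
  simp only [Finset.sum_mul]
  rw [Finset.sum_sigma', Finset.sum_sigma']
  refine Finset.sum_bij_ne_zero (fun x _ _ => ⟨x.1 + x.2, x.2⟩) ?_ ?_ ?_ ?_
  · rintro ⟨n, m⟩ h1 h2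
    simp only [Finset.mem_sigma, Finset.mem_range] at h1 ⊢
    have : t - 1 - m - n ≠ 0 := fun h => h2 (by simp [h])
    omega
  · rintro ⟨n, m⟩ h1 h2 ⟨n', m'⟩ h1' h2' e
    simp only [Sigma.mk.injEq, heq_eq_eq] at e ⊢
    omega
  · rintro ⟨N, m⟩ h1 h2
    simp only [Finset.mem_sigma, Finset.mem_range] at h1
    refine ⟨⟨N-m, m⟩, ?_, ?_, ?_⟩
    · simp only [Finset.mem_sigma, Finset.mem_range]; omega
    · have : t - 1 - m - (N - m) = t - 1 - N := by omega
      simpa only [this] using h2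
    · simp only [Sigma.mk.injEq, heq_eq_eq, and_true]; omega
  · rintro ⟨n, m⟩ h1 h2
    simp only
    rw [Nat.add_sub_cancel, show t - 1 - (n+m) = t - 1 - m - n by omega]

theorem magilatin_cubic_principal (t : ℕ) (ht : 0 < t) (hdvd : 60 ∣ t) :
    120 * (Lc t : ℤ) =
      36*(t : ℤ)^5 - 765*(t : ℤ)^4 + 8080*(t : ℤ)^3
        - 45228*(t : ℤ)^2 + 119280*(t : ℤ) - 113760 := by
  obtain ⟨k, rfl⟩ : ∃ k, t = 60*(k+1) := by
    obtain ⟨j, rfl⟩ := hdvd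
    exact ⟨j-1, by omega⟩
  have hf := sum_final k
  rw [Lc_sum, regroup, Finset.mul_sum]
  have h : ∀ N ∈ Finset.range (60*(k+1)), 2 * ((∑ m ∈ Finset.range ((N+1)/2), V m (N-m)) *
      ((60*(k+1) - 1 - N : ℕ):ℤ)) = (F12 N + F5 N) * (60*((k:ℤ)+1) - 1 - N)
      - if N = 0 then (F12 0 + F5 0) * (60*((k:ℤ)+1) - 1) else 0 := by
    intro N hN
    have := Finset.mem_range.1 hN
    rcases Nat.eq_zero_or_pos N with rfl | h0
    · simp
    · rw [← mul_assoc, F_eq N h0, if_neg (by omega),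
        show ((60*(k+1) - 1 - N : ℕ):ℤ) = 60*((k:ℤ)+1) - 1 - N by omega, sub_zero]
  rw [Finset.sum_congr rfl h, Finset.sum_sub_distrib, Finset.sum_ite_eq', if_pos (by simp)]
  push_cast
  linear_combination hf
end
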